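/- arXiv:1805.02471 — 2 statements merged into one kernel-verified Lean document; each statement's English description precedes it below -/
import Mathlib

section
/- If A : (0,∞) → S₊ is an S₊-valued Bernstein function, then the function p ↦ p·Ã(p), where Ã(p) = ∫₀^∞ e^{−pt} A(t) dt is the Laplace transform of A, is an S₊-valued Stieltjes function on (0,∞). -/
open MeasureTheory Set Filter Topology Matrix

noncomputable section

/-- A matrix-valued function `A` on `(0,∞)` is completely monotone (CM): each entry is
infinitely differentiable on `(0,∞)` and for every `v : ℝ^m` and `n : ℕ`,
`(-1)^n (d/dt)^n (vᵀ A(t) v) ≥ 0` for `t > 0`. -/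
def MatCM (m : ℕ) (A : ℝ → Matrix (Fin m) (Fin m) ℝ) : Prop :=
  (∀ i j, ContDiffOn ℝ (⊤ : ℕ∞) (fun t => A t i j) (Set.Ioi 0)) ∧
  ∀ v : Fin m → ℝ, ∀ n : ℕ, ∀ t ∈ Set.Ioi (0:ℝ),
    0 ≤ (-1 : ℝ) ^ n * iteratedDeriv n (fun s => v ⬝ᵥ (A s).mulVec v) t

/-- Locally integrable completely monotone (LICM): CM and integrable over `(0,1]`. -/
def MatLICM (m : ℕ) (A : ℝ → Matrix (Fin m) (Fin m) ℝ) : Prop :=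
  MatCM m A ∧ ∀ i j, MeasureTheory.IntegrableOn (fun t => A t i j) (Set.Ioc 0 1)

/-- Entrywise derivative of a matrix-valued function. -/
def matDeriv (m : ℕ) (A : ℝ → Matrix (Fin m) (Fin m) ℝ) : ℝ → Matrix (Fin m) (Fin m) ℝ :=
  fun t => Matrix.of fun i j => deriv (fun s => A s i j) t

/-- A matrix-valued Bernstein function: differentiable on `(0,∞)` with CM derivative. -/
def MatBernstein (m : ℕ) (A : ℝ → Matrix (Fin m) (Fin m) ℝ) : Prop :=
  (∀ i j, DifferentiableOn ℝ (fun t => A t i j) (Set.Ioi 0)) ∧ MatCM m (matDeriv m A)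

/-- The Laplace transform `Ã(p) = ∫₀^∞ e^{-pt} A(t) dt` (entrywise). -/
def matLaplace (m : ℕ) (A : ℝ → Matrix (Fin m) (Fin m) ℝ) (p : ℝ) :
    Matrix (Fin m) (Fin m) ℝ :=
  Matrix.of fun i j => ∫ t in Set.Ioi (0:ℝ), Real.exp (-p * t) * A t i j

/-- Convolution of matrix-valued functions: `(A∗B)(t) = ∫₀ᵗ A(s) B(t-s) ds`. -/
def matConv (m : ℕ) (A B : ℝ → Matrix (Fin m) (Fin m) ℝ) (t : ℝ) :
    Matrix (Fin m) (Fin m) ℝ :=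
  Matrix.of fun i j => ∫ s in (0:ℝ)..t, ∑ k, A s i k * B (t - s) k j

/-- Convolution of a matrix-valued function with a vector-valued function:
`(A∗v)(t) = ∫₀ᵗ A(s) v(t-s) ds`. -/
def matVecConv (m : ℕ) (A : ℝ → Matrix (Fin m) (Fin m) ℝ) (v : ℝ → Fin m → ℝ) (t : ℝ) :
    Fin m → ℝ :=
  fun i => ∫ s in (0:ℝ)..t, ∑ k, A s i k * v (t - s) k

/-- An `S₊`-valued Stieltjes function: `Y(p) = C + ∫_{[0,∞)} (p + r)⁻¹ G(r) μ(dr)` with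
`C ∈ S₊`, `μ` a Borel measure on `[0,∞)` with `∫ (1+r)⁻¹ μ(dr) < ∞`, and `G` a measurable
`S₊`-valued function bounded `μ`-almost everywhere. -/
def IsStieltjesM (m : ℕ) (Y : ℝ → Matrix (Fin m) (Fin m) ℝ) : Prop :=
  ∃ (C : Matrix (Fin m) (Fin m) ℝ) (μ : MeasureTheory.Measure ℝ)
    (G : ℝ → Matrix (Fin m) (Fin m) ℝ),
    C.PosSemidef ∧ μ (Set.Iio 0) = 0 ∧
    (∫⁻ r in Set.Ici (0:ℝ), ENNReal.ofReal ((1 + r)⁻¹) ∂μ) < ⊤ ∧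
    (∀ i j, Measurable fun r => G r i j) ∧
    (∀ᵐ r ∂μ, (G r).PosSemidef) ∧
    (∃ M : ℝ, ∀ᵐ r ∂μ, ∀ i j, |G r i j| ≤ M) ∧
    ∀ p ∈ Set.Ioi (0:ℝ),
      Y p = C + Matrix.of fun i j => ∫ r in Set.Ici (0:ℝ), (p + r)⁻¹ * G r i j ∂μ

/-- An `S₊`-valued complete Bernstein function (CBF):
`Z(p) = p·B + p·∫_{[0,∞)} (p + r)⁻¹ H(r) ν(dr)` with `B ∈ S₊`, `ν` a Borel measure on
`[0,∞)` with `∫ (1+r)⁻¹ ν(dr) < ∞`, and `H` a measurable `S₊`-valued function bounded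
`ν`-almost everywhere. -/
def IsCBFM (m : ℕ) (Z : ℝ → Matrix (Fin m) (Fin m) ℝ) : Prop :=
  ∃ (B : Matrix (Fin m) (Fin m) ℝ) (ν : MeasureTheory.Measure ℝ)
    (H : ℝ → Matrix (Fin m) (Fin m) ℝ),
    B.PosSemidef ∧ ν (Set.Iio 0) = 0 ∧
    (∫⁻ r in Set.Ici (0:ℝ), ENNReal.ofReal ((1 + r)⁻¹) ∂ν) < ⊤ ∧
    (∀ i j, Measurable fun r => H r i j) ∧
    (∀ᵐ r ∂ν, (H r).PosSemidef) ∧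
    (∃ M : ℝ, ∀ᵐ r ∂ν, ∀ i j, |H r i j| ≤ M) ∧
    ∀ p ∈ Set.Ioi (0:ℝ),
      Z p = p • B + Matrix.of fun i j => ∫ r in Set.Ici (0:ℝ), p * (p + r)⁻¹ * H r i j ∂ν

open scoped NNReal ENNReal

/-- A real function is completely monotone on `(0,∞)` when it is smooth there and its derivatives
alternate in sign. -/
def IsCMOn (f : ℝ → ℝ) : Prop :=
  ContDiffOn ℝ (⊤ : ℕ∞) f (Ioi 0) ∧ ∀ n : ℕ, ∀ t ∈ Ioi (0 : ℝ), 0 ≤ (-1 : ℝ) ^ n * iteratedDeriv n f t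

namespace IsCMOn

variable {f : ℝ → ℝ}

lemma contDiffAt (hf : IsCMOn f) {t : ℝ} (ht : 0 < t) : ContDiffAt ℝ (⊤ : ℕ∞) f t :=
  hf.1.contDiffAt (Ioi_mem_nhds ht)

lemma nonneg (hf : IsCMOn f) {t : ℝ} (ht : 0 < t) : 0 ≤ f t := by
  simpa using hf.2 0 t ht

lemma differentiableAt_iteratedDeriv (hf : IsCMOn f) (n : ℕ) {t : ℝ} (ht : 0 < t) :
    DifferentiableAt ℝ (iteratedDeriv n f) t := by
  rw [← iteratedDerivWithin_univ]
  exact ((hf.contDiffAt ht).contDiffWithinAt (s := univ)).differentiableWithinAt_iteratedDerivWithin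
    (by exact_mod_cast WithTop.coe_lt_top n) (by simp) |>.differentiableAt
    univ_mem

/-- The alternating derivatives of a completely monotone function are nonincreasing. -/
lemma antitoneOn_iteratedDeriv (hf : IsCMOn f) (n : ℕ) :
    AntitoneOn (fun t => (-1 : ℝ) ^ n * iteratedDeriv n f t) (Ioi 0) := by
  have hd : ∀ t ∈ Ioi (0 : ℝ), DifferentiableAt ℝ (fun t => (-1 : ℝ) ^ n * iteratedDeriv n f t) t :=
    fun t ht => (hf.differentiableAt_iteratedDeriv n ht).const_mul _
  refine antitoneOn_of_deriv_nonpos (convex_Ioi 0)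
    (fun t ht => (hd t ht).continuousAt.continuousWithinAt)
    (fun t ht => (hd t (interior_subset ht)).differentiableWithinAt) fun t ht => ?_
  have ht' : 0 < t := interior_subset ht
  rw [deriv_const_mul _ (hf.differentiableAt_iteratedDeriv n ht'), ← iteratedDeriv_succ]
  have := hf.2 (n + 1) t ht'
  rw [pow_succ] at this
  linarith

lemma antitoneOn (hf : IsCMOn f) : AntitoneOn f (Ioi 0) := by
  simpa using hf.antitoneOn_iteratedDeriv 0

lemma continuousAt (hf : IsCMOn f) {t : ℝ} (ht : 0 < t) : ContinuousAt f t :=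
  (hf.contDiffAt ht).continuousAt

lemma sub_shift (hf : IsCMOn f) {h : ℝ} (hh : 0 ≤ h) : IsCMOn (fun t => f t - f (t + h)) := by
  have hs : ∀ t : ℝ, 0 < t → ContDiffAt ℝ (⊤ : ℕ∞) (fun t => f (t + h)) t := fun t ht =>
    (hf.contDiffAt (t := t + h) (by linarith)).comp t (by fun_prop)
  refine ⟨fun t ht => ((hf.contDiffAt ht).sub (hs t ht)).contDiffWithinAt, fun n t ht => ?_⟩
  have hle : ((n : ℕ∞) : WithTop ℕ∞) ≤ ((⊤ : ℕ∞) : WithTop ℕ∞) := by exact_mod_cast le_top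
  rw [iteratedDeriv_fun_sub ((hf.contDiffAt ht).of_le hle) ((hs t ht).of_le hle),
    iteratedDeriv_comp_add_const]
  have := hf.antitoneOn_iteratedDeriv n ht (show t + h ∈ Ioi (0 : ℝ) from by
    simp only [mem_Ioi] at *; linarith) (by linarith)
  simp only at this
  linarith

lemma fwdDiff_iter (hf : IsCMOn f) {h : ℝ} (hh : 0 ≤ h) (n : ℕ) :
    IsCMOn (fun t => (-1 : ℝ) ^ n * (fwdDiff h)^[n] f t) := by
  induction n with
  | zero => simpa using hf
  | succ n ih =>
    convert ih.sub_shift hh using 2 with t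
    rw [Function.iterate_succ_apply', fwdDiff, pow_succ]
    ring

end IsCMOn

/-- The binomial expansion of `1 = (S - Δ) ^ n`, with `S` the shift by `h`. -/
lemma sum_choose_mul_fwdDiff_iter_shift (f : ℝ → ℝ) (h x : ℝ) (n : ℕ) :
    ∑ l ∈ Finset.range (n + 1),
      (n.choose l : ℝ) * ((-1 : ℝ) ^ (n - l) * (fwdDiff h)^[n - l] f (x + l * h)) = f x := by
  have hc : Commute (fwdDiff_aux.shiftₗ ℝ ℝ h) (-fwdDiff_aux.fwdDiffₗ ℝ ℝ h) :=
    Commute.neg_right (((Commute.refl _).add_left (Commute.one_left _)))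
  have h1 : fwdDiff_aux.shiftₗ ℝ ℝ h + -fwdDiff_aux.fwdDiffₗ ℝ ℝ h = 1 := by
    simp [fwdDiff_aux.shiftₗ]
  have := congr_fun (LinearMap.congr_fun (hc.add_pow n) f) x
  rw [h1, one_pow, LinearMap.sum_apply, Finset.sum_apply] at this
  rw [show f x = (1 : Module.End ℤ (ℝ → ℝ)) f x from rfl, this]
  refine Finset.sum_congr rfl fun l _ => ?_
  have e : ((-fwdDiff_aux.fwdDiffₗ ℝ ℝ h) ^ (n - l)) f
      = fun y => (-1 : ℝ) ^ (n - l) * (fwdDiff h)^[n - l] f y := by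
    rcases Nat.even_or_odd (n - l) with hl | hl
    · rw [hl.neg_pow, hl.neg_one_pow, fwdDiff_aux.coe_fwdDiffₗ_pow]
      simp
    · rw [hl.neg_pow, hl.neg_one_pow, LinearMap.neg_apply, fwdDiff_aux.coe_fwdDiffₗ_pow]
      ext y
      simp
  rw [← nsmul_eq_mul', LinearMap.smul_apply, Pi.smul_apply, Module.End.mul_apply, e,
    fwdDiff_aux.shiftₗ_pow_apply, nsmul_eq_mul, nsmul_eq_mul]

/-- The ratio of binomial coefficients `C(k,j) / C(n,j)` is close to `(k/n)^j`. -/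
lemma pow_sub_choose_div_choose_mem {k n J : ℕ} (hkn : k ≤ n) (hJ : J < n) (j : ℕ) (hj : j + 1 ≤ J) :
    0 ≤ (k.choose (j + 1) : ℝ) / n.choose (j + 1) ∧
    0 ≤ ((k : ℝ) / n) ^ (j + 1) - (k.choose (j + 1) : ℝ) / n.choose (j + 1) ∧
    ((k : ℝ) / n) ^ (j + 1) - (k.choose (j + 1) : ℝ) / n.choose (j + 1) ≤
      (k : ℝ) / n * (j * J / (n - J)) := by
  have hn : (0 : ℝ) < n := by exact_mod_cast (Nat.zero_le J).trans_lt hJ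
  have hJn : (J : ℝ) < n := by exact_mod_cast hJ
  have hkn' : (k : ℝ) ≤ n := by exact_mod_cast hkn
  have hx0 : 0 ≤ (k : ℝ) / n := by positivity
  have hx1 : (k : ℝ) / n ≤ 1 := (div_le_one hn).2 hkn'
  refine ⟨by positivity, ?_⟩
  induction j with
  | zero => simp
  | succ j ih =>
    obtain ⟨h1, h2⟩ := ih (by omega)
    have hjJ : (j : ℝ) + 1 ≤ J := by exact_mod_cast (by omega : j + 1 ≤ J)
    have hnj : (0 : ℝ) < n - (j + 1 : ℕ) := by push_cast; linarith
    set x := (k : ℝ) / n with hx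
    set P := (k.choose (j + 1) : ℝ) / n.choose (j + 1) with hP
    have hP0 : 0 ≤ P := by positivity
    have step : (k.choose (j + 1 + 1) : ℝ) / n.choose (j + 1 + 1)
        = P * ((k - (j + 1 : ℕ)) / (n - (j + 1 : ℕ))) := by
      have e1 : ∀ k : ℕ, (k.choose (j + 1 + 1) : ℝ) * (j + 1 + 1) = k.choose (j + 1) * (k - (j + 1 : ℕ)) := by
        intro k
        rcases le_or_gt (j + 1) k with hk | hk
        · rw [← Nat.cast_sub hk]
          exact_mod_cast Nat.choose_succ_right_eq k (j + 1)
        · rw [Nat.choose_eq_zero_of_lt hk, Nat.choose_eq_zero_of_lt (by omega)]; simp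
      have c1 : (0 : ℝ) < n.choose (j + 1) := by exact_mod_cast Nat.choose_pos (by omega)
      have c2 : (0 : ℝ) < n.choose (j + 1 + 1) := by exact_mod_cast Nat.choose_pos (by omega)
      have := e1 k
      have := e1 n
      rw [hP, div_mul_div_comm, div_eq_div_iff c2.ne' (by positivity)]
      have hj2 : (0 : ℝ) < (j : ℝ) + 1 + 1 := by positivity
      apply mul_right_cancel₀ hj2.ne'
      linear_combination (n.choose (j + 1) : ℝ) * (n - (j + 1 : ℕ)) * e1 k -
        (k.choose (j + 1) : ℝ) * (k - (j + 1 : ℕ)) * e1 n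
    have hd0 : 0 ≤ x - (k - (j + 1 : ℕ)) / (n - (j + 1 : ℕ)) := by
      rw [hx, div_sub_div _ _ hn.ne' hnj.ne']
      refine div_nonneg ?_ (by positivity)
      push_cast
      nlinarith
    have hd1 : x - (k - (j + 1 : ℕ)) / (n - (j + 1 : ℕ)) ≤ J / (n - J) := by
      rw [hx, div_sub_div _ _ hn.ne' hnj.ne']
      calc _ ≤ ((j : ℝ) + 1) * n / (n * (n - (j + 1 : ℕ))) := by
            gcongr
            push_cast
            nlinarith [mul_nonneg (show (0 : ℝ) ≤ j + 1 by positivity) (Nat.cast_nonneg (α := ℝ) k)]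
        _ = ((j : ℝ) + 1) / (n - (j + 1 : ℕ)) := by field_simp
        _ ≤ J / (n - J) := by
            push_cast
            have : 0 < (n : ℝ) - J := by linarith
            gcongr
    have hPx : P ≤ x := by
      have : x ^ (j + 1) ≤ x := pow_le_of_le_one hx0 hx1 (by omega)
      linarith
    set d := ((k : ℝ) - (j + 1 : ℕ)) / (n - (j + 1 : ℕ)) with hd
    rw [step, pow_succ]
    have key : x ^ (j + 1) * x - P * d = (x ^ (j + 1) - P) * x + P * (x - d) := by ring
    rw [key]
    constructor
    · positivity
    · have a1 : (x ^ (j + 1) - P) * x ≤ x * (j * J / (n - J)) :=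
        (mul_le_of_le_one_right h1 hx1).trans h2
      have a2 : P * (x - d) ≤ x * (J / (n - J)) := mul_le_mul hPx hd1 hd0 hx0
      calc _ ≤ _ := add_le_add a1 a2
        _ = _ := by push_cast; ring
/-- A positive functional on functions on `[0,∞)`. -/
def IsPosFunctional (S : (ℝ≥0 → ℝ) →ₗ[ℝ] ℝ) : Prop :=
  ∀ φ : ℝ≥0 → ℝ, (∀ r, 0 ≤ φ r) → 0 ≤ S φ

lemma IsPosFunctional.mono {S : (ℝ≥0 → ℝ) →ₗ[ℝ] ℝ} (hS : IsPosFunctional S) {φ ψ : ℝ≥0 → ℝ}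
    (h : ∀ r, φ r ≤ ψ r) : S φ ≤ S ψ := by
  have := hS (ψ - φ) fun r => sub_nonneg.2 (h r)
  rw [map_sub] at this
  linarith

lemma sum_choose_div_choose_mul_fwdDiff_iter (f : ℝ → ℝ) (h : ℝ) {n j : ℕ} (hj : 1 ≤ j)
    (hjn : j ≤ n) :
    ∑ k ∈ Finset.range n, ((k + 1).choose j : ℝ) / n.choose j * (n.choose (k + 1) *
      ((-1 : ℝ) ^ (n - (k + 1)) * (fwdDiff h)^[n - (k + 1)] f ((k + 1 : ℕ) * h))) = f (j * h) := by
  set T : ℕ → ℝ := fun k => (k.choose j : ℝ) / n.choose j * (n.choose k *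
      ((-1 : ℝ) ^ (n - k) * (fwdDiff h)^[n - k] f (k * h))) with hT
  have h0 : ∀ k < j, T k = 0 := fun k hk => by simp [hT, Nat.choose_eq_zero_of_lt hk]
  have hsum : ∑ k ∈ Finset.range (n + 1), T k = ∑ k ∈ Finset.range n, T (k + 1) := by
    rw [Finset.sum_range_succ', h0 0 (by omega), add_zero]
  change ∑ k ∈ Finset.range n, T (k + 1) = _
  rw [← hsum, show n + 1 = j + (n - j + 1) by omega, Finset.sum_range_add,
    Finset.sum_eq_zero (fun k hk => h0 k (Finset.mem_range.1 hk)), zero_add,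
    ← sum_choose_mul_fwdDiff_iter_shift f h (j * h) (n - j)]
  refine Finset.sum_congr rfl fun l hl => ?_
  have hl' : j + l ≤ n := by have := Finset.mem_range.1 hl; omega
  have hc := Nat.choose_mul (n := n) (Nat.le_add_right j l)
  have hp : (0 : ℝ) < n.choose j := by exact_mod_cast Nat.choose_pos hjn
  have hc' : ((j + l).choose j : ℝ) / n.choose j * n.choose (j + l) = (n - j).choose l := by
    rw [div_mul_eq_mul_div, div_eq_iff hp.ne']
    rw [Nat.add_sub_cancel_left] at hc
    have : (n.choose (j + l) : ℝ) * (j + l).choose j = n.choose j * (n - j).choose l := by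
      exact_mod_cast hc
    linarith
  simp only [hT]
  rw [← mul_assoc, hc', Nat.sub_sub, Nat.cast_add, add_mul]

/-- A completely monotone function is approximated on a finite arithmetic progression by
Laplace transforms of discrete measures. -/
lemma IsCMOn.exists_posFunctional {f : ℝ → ℝ} (hf : IsCMOn f) {h : ℝ} (hh : 0 < h) (J : ℕ)
    {ε : ℝ} (hε : 0 < ε) :
    ∃ S : (ℝ≥0 → ℝ) →ₗ[ℝ] ℝ, IsPosFunctional S ∧ ∀ j : ℕ, 1 ≤ j → j ≤ J →
      |S (fun r => Real.exp (-(r * (j * h)))) - f (j * h)| ≤ ε := by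
  have hlim : Tendsto (fun n : ℕ => f h * ((J : ℝ) * J / (n - J))) atTop (𝓝 (f h * 0)) := by
    refine Tendsto.const_mul _ (Tendsto.const_div_atTop ?_ _)
    exact tendsto_atTop_add_const_right _ _ tendsto_natCast_atTop_atTop
  rw [mul_zero] at hlim
  obtain ⟨n, hn, hJn⟩ := ((hlim.eventually (gt_mem_nhds hε)).and (eventually_gt_atTop J)).exists
  have hn0 : (0 : ℝ) < n := by exact_mod_cast (Nat.zero_le J).trans_lt hJn
  set w : ℕ → ℝ := fun k => n.choose (k + 1) *
    ((-1 : ℝ) ^ (n - (k + 1)) * (fwdDiff h)^[n - (k + 1)] f ((k + 1 : ℕ) * h)) with hw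
  have hw0 : ∀ k, 0 ≤ w k := fun k =>
    mul_nonneg (by positivity) ((hf.fwdDiff_iter hh.le _).nonneg (by positivity))
  set ρ : ℕ → ℝ≥0 := fun k => Real.toNNReal (-Real.log (((k + 1 : ℕ) : ℝ) / n) / h) with hρ
  have hexp : ∀ k ∈ Finset.range n, ∀ j : ℕ,
      Real.exp (-(ρ k * (j * h))) = (((k + 1 : ℕ) : ℝ) / n) ^ j := by
    intro k hk j
    have hk' : ((k + 1 : ℕ) : ℝ) ≤ n := by exact_mod_cast Finset.mem_range.1 hk
    have hx : (0 : ℝ) < ((k + 1 : ℕ) : ℝ) / n := by positivity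
    have hl : Real.log (((k + 1 : ℕ) : ℝ) / n) ≤ 0 :=
      Real.log_nonpos hx.le ((div_le_one hn0).2 hk')
    rw [hρ, Real.coe_toNNReal _ (div_nonneg (by linarith) hh.le)]
    rw [show -(-Real.log (((k + 1 : ℕ) : ℝ) / n) / h * (j * h))
      = j * Real.log (((k + 1 : ℕ) : ℝ) / n) by field_simp, Real.exp_nat_mul, Real.exp_log hx]
  refine ⟨∑ k ∈ Finset.range n, w k • LinearMap.proj (ρ k), ?_, fun j hj hjJ => ?_⟩
  · intro φ hφ
    simp only [LinearMap.sum_apply, LinearMap.smul_apply, LinearMap.proj_apply, smul_eq_mul]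
    exact Finset.sum_nonneg fun k _ => mul_nonneg (hw0 k) (hφ _)
  · simp only [LinearMap.sum_apply, LinearMap.smul_apply, LinearMap.proj_apply, smul_eq_mul]
    rw [Finset.sum_congr rfl fun k hk => by rw [hexp k hk j],
      ← sum_choose_div_choose_mul_fwdDiff_iter f h hj (by omega : j ≤ n), ← Finset.sum_sub_distrib]
    have hfh : ∑ k ∈ Finset.range n, ((k + 1 : ℕ) : ℝ) / n * w k = f h := by
      have := sum_choose_div_choose_mul_fwdDiff_iter f h le_rfl
        (show 1 ≤ n by have := hj.trans hjJ; omega)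
      simpa only [Nat.choose_one_right, Nat.cast_one, one_mul] using this
    have hJ' : (0 : ℝ) < n - J := sub_pos.2 (by exact_mod_cast hJn)
    obtain ⟨i, rfl⟩ : ∃ i, j = i + 1 := ⟨j - 1, by omega⟩
    have hest : ∀ k ∈ Finset.range n, |w k * (((k + 1 : ℕ) : ℝ) / n) ^ (i + 1) -
        ((k + 1).choose (i + 1) : ℝ) / n.choose (i + 1) * w k| ≤
        ((k + 1 : ℕ) : ℝ) / n * w k * ((J : ℝ) * J / (n - J)) := by
      intro k hk
      obtain ⟨-, h1, h2⟩ := pow_sub_choose_div_choose_mem (Finset.mem_range.1 hk) hJn i hjJ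
      rw [mul_comm (w k), ← sub_mul, abs_of_nonneg (mul_nonneg h1 (hw0 k)), mul_right_comm]
      refine mul_le_mul_of_nonneg_right (h2.trans ?_) (hw0 k)
      have : (i : ℝ) ≤ J := by exact_mod_cast (by omega : i ≤ J)
      gcongr
    refine (Finset.abs_sum_le_sum_abs _ _).trans ((Finset.sum_le_sum hest).trans ?_)
    rw [← Finset.sum_mul, hfh]
    exact hn.le

lemma IsCMOn.exists_seq_posFunctional {f : ℝ → ℝ} (hf : IsCMOn f) :
    ∃ S : ℕ → ((ℝ≥0 → ℝ) →ₗ[ℝ] ℝ), (∀ N, IsPosFunctional (S N)) ∧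
      ∀ q : ℚ, 0 < q → Tendsto (fun N => S N fun r => Real.exp (-(r * q))) atTop (𝓝 (f q)) := by
  have hfac : ∀ N : ℕ, (0 : ℝ) < 1 / (N.factorial : ℝ) := fun N => by positivity
  choose S hS hS' using fun N : ℕ =>
    hf.exists_posFunctional (hfac N) (N * N.factorial) (Nat.one_div_pos_of_nat (α := ℝ) (n := N))
  refine ⟨S, hS, fun q hq => ?_⟩
  rw [tendsto_iff_norm_sub_tendsto_zero]
  refine squeeze_zero' (.of_forall fun _ => norm_nonneg _) ?_
    (tendsto_one_div_add_atTop_nhds_zero_nat (𝕜 := ℝ))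
  filter_upwards [eventually_ge_atTop q.den, eventually_ge_atTop q.num.toNat] with N h1 h2
  obtain ⟨c, hc⟩ := Nat.dvd_factorial q.den_pos h1
  have hcpos : 0 < c := Nat.pos_of_mul_pos_left (hc ▸ N.factorial_pos)
  have hnum : 0 < q.num := Rat.num_pos.2 hq
  have hj : ((q.num.toNat * c : ℕ) : ℝ) * (1 / (N.factorial : ℝ)) = q := by
    have e1 : (q.num.toNat : ℝ) = q.num := by exact_mod_cast Int.toNat_of_nonneg hnum.le
    have hd : (q.den : ℝ) ≠ 0 := by exact_mod_cast q.den_nz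
    have hc0 : (c : ℝ) ≠ 0 := by exact_mod_cast hcpos.ne'
    rw [hc, Rat.cast_def q]
    push_cast
    rw [e1]
    field_simp
  have := hS' N (q.num.toNat * c) (Nat.mul_pos (by omega) hcpos)
    (Nat.mul_le_mul h2 (Nat.le_of_dvd N.factorial_pos ⟨q.den, by rw [hc, mul_comm]⟩))
  rw [hj] at this
  exact this
lemma continuous_exp_neg_mul (t : ℝ) : Continuous fun r : ℝ≥0 => Real.exp (-(r * t)) := by fun_prop

lemma measurable_ofReal_exp_neg_mul (t : ℝ) :
    Measurable fun r : ℝ≥0 => ENNReal.ofReal (Real.exp (-(r * t))) :=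
  (continuous_exp_neg_mul t).measurable.ennreal_ofReal

/-- The exponential `r ↦ exp (-r * t)` cut off to have compact support. -/
def cutoffExp (R t : ℝ) : CompactlySupportedContinuousMap ℝ≥0 ℝ where
  toFun r := max 0 (min 1 (R + 1 - r)) * Real.exp (-(r * t))
  continuous_toFun := by fun_prop
  hasCompactSupport' := by
    refine HasCompactSupport.intro (isCompact_Icc (a := (0 : ℝ≥0)) (b := (R + 1).toNNReal))
      fun r hr => ?_
    have : R + 1 < r := by
      by_contra! h
      exact hr ⟨zero_le, NNReal.le_toNNReal_of_coe_le h⟩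
    rw [max_eq_left ((min_le_right _ _).trans (by linarith)), zero_mul]

lemma cutoffExp_apply (R t : ℝ) (r : ℝ≥0) :
    cutoffExp R t r = max 0 (min 1 (R + 1 - r)) * Real.exp (-(r * t)) := rfl

lemma cutoffExp_nonneg (R t : ℝ) (r : ℝ≥0) : 0 ≤ cutoffExp R t r :=
  mul_nonneg (le_max_left _ _) (Real.exp_pos _).le

lemma cutoffExp_le (R t : ℝ) (r : ℝ≥0) : cutoffExp R t r ≤ Real.exp (-(r * t)) :=
  mul_le_of_le_one_left (Real.exp_pos _).le (max_le zero_le_one (min_le_left _ _))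

lemma cutoffExp_eq {R : ℝ} (t : ℝ) {r : ℝ≥0} (hr : (r : ℝ) ≤ R) :
    cutoffExp R t r = Real.exp (-(r * t)) := by
  rw [cutoffExp_apply, min_eq_left (by linarith), max_eq_right zero_le_one, one_mul]

lemma cutoffExp_mono (t : ℝ) (r : ℝ≥0) {R R' : ℝ} (h : R ≤ R') :
    cutoffExp R t r ≤ cutoffExp R' t r := by
  rw [cutoffExp_apply, cutoffExp_apply]
  gcongr

lemma exp_sub_cutoffExp_le {R t : ℝ} (ht : 0 < t) (r : ℝ≥0) :
    Real.exp (-(r * t)) - cutoffExp R t r ≤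
      Real.exp (-(R * (t / 2))) * Real.exp (-(r * (t / 2))) := by
  rcases le_or_gt (r : ℝ) R with h | h
  · rw [cutoffExp_eq t h, sub_self]
    positivity
  · refine (sub_le_self _ (cutoffExp_nonneg _ _ _)).trans ?_
    rw [← Real.exp_add]
    gcongr
    nlinarith

/-- Helly-type selection: if positive functionals on `[0,∞)` have Laplace transforms converging
on the positive rationals to a continuous function, that function is the Laplace transform of a
measure. -/
lemma exists_measure_of_tendsto_posFunctional {f : ℝ → ℝ} (hf : ∀ t, 0 < t → ContinuousAt f t)
    (S : ℕ → ((ℝ≥0 → ℝ) →ₗ[ℝ] ℝ)) (hS : ∀ N, IsPosFunctional (S N))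
    (hlim : ∀ q : ℚ, 0 < q →
      Tendsto (fun N => S N fun r => Real.exp (-(r * q))) atTop (𝓝 (f q))) :
    ∃ μ : Measure ℝ≥0, SigmaFinite μ ∧ ∀ t : ℝ, 0 < t →
      ∫⁻ r, ENNReal.ofReal (Real.exp (-(r * t))) ∂μ = ENNReal.ofReal (f t) := by
  set U : Ultrafilter ℕ := hyperfilter ℕ
  have hU : (U : Filter ℕ) ≤ atTop := Nat.hyperfilter_le_atTop
  have hlimU : ∀ q : ℚ, 0 < q →
      Tendsto (fun N => S N fun r => Real.exp (-(r * q))) U (𝓝 (f q)) :=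
    fun q hq => (hlim q hq).mono_left hU
  have hex : ∀ φ : CompactlySupportedContinuousMap ℝ≥0 ℝ,
      ∃ y, Tendsto (fun N => S N φ) U (𝓝 y) := by
    intro φ
    have hcs : HasCompactSupport fun r : ℝ≥0 => φ r * Real.exp r := φ.hasCompactSupport.mul_right
    obtain ⟨C, hC⟩ := hcs.exists_bound_of_continuous (by fun_prop)
    have hC' : ∀ r : ℝ≥0, |φ r| ≤ C * Real.exp (-(r * (1 : ℚ))) := by
      intro r
      have := hC r
      rw [norm_mul, Real.norm_eq_abs, Real.norm_eq_abs, Real.abs_exp] at this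
      rw [Rat.cast_one, mul_one, Real.exp_neg, ← div_eq_mul_inv, le_div_iff₀ (Real.exp_pos _)]
      exact this
    have hle : ∀ N, |S N φ| ≤ C * S N fun r => Real.exp (-(r * (1 : ℚ))) := by
      intro N
      rw [← smul_eq_mul, ← map_smul, abs_le, ← map_neg]
      exact ⟨(hS N).mono fun r => neg_le_of_abs_le (hC' r),
        (hS N).mono fun r => le_of_abs_le (hC' r)⟩
    have hb : ∀ᶠ N in (U : Filter ℕ), S N φ ∈ Icc (-(C * f (1 : ℚ) + 1)) (C * f (1 : ℚ) + 1) := by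
      filter_upwards [((hlimU 1 one_pos).const_mul C).eventually (gt_mem_nhds (lt_add_one _))]
        with N hN
      exact abs_le.1 ((hle N).trans hN.le)
    obtain ⟨y, -, hy⟩ := isCompact_Icc.ultrafilter_le_nhds (U.map fun N => S N φ)
      (le_principal_iff.2 hb)
    exact ⟨y, hy⟩
  choose L hL using hex
  let Λ : PositiveLinearMap ℝ (CompactlySupportedContinuousMap ℝ≥0 ℝ) ℝ :=
    { toFun := L
      map_add' := fun φ ψ => tendsto_nhds_unique (hL _) (by
        simpa using (hL φ).add (hL ψ))
      map_smul' := fun c φ => tendsto_nhds_unique (hL _) (by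
        simpa using (hL φ).const_mul c)
      monotone' := fun φ ψ h => le_of_tendsto_of_tendsto (hL φ) (hL ψ)
        (.of_forall fun N => (hS N).mono h) }
  set μ := RealRMK.rieszMeasure Λ
  have hint : ∀ φ, ∫ r, φ r ∂μ = L φ := fun φ => RealRMK.integral_rieszMeasure Λ φ
  have hup : ∀ (R : ℝ) (q : ℚ), 0 < q → L (cutoffExp R q) ≤ f q := fun R q hq =>
    le_of_tendsto_of_tendsto (hL _) (hlimU q hq)
      (.of_forall fun N => (hS N).mono (cutoffExp_le R q))
  have hlow : ∀ (R : ℝ) (q : ℚ), 0 < q →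
      f q - Real.exp (-(R * (q / 2))) * f (q / 2) ≤ L (cutoffExp R q) := by
    intro R q hq
    have h2 := hlimU (q / 2) (by positivity)
    push_cast at h2
    refine le_of_tendsto_of_tendsto ((hlimU q hq).sub (h2.const_mul _)) (hL _)
      (.of_forall fun N => ?_)
    have := (hS N).mono (φ := (fun r : ℝ≥0 => Real.exp (-(r * q))) - (cutoffExp R q : ℝ≥0 → ℝ))
      (ψ := Real.exp (-(R * (q / 2))) • fun r : ℝ≥0 => Real.exp (-(r * (q / 2))))
      (exp_sub_cutoffExp_le (t := q) (by exact_mod_cast hq))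
    rw [map_sub, map_smul, smul_eq_mul] at this
    simp only
    linarith
  have hrat : ∀ q : ℚ, 0 < q →
      ∫⁻ r, ENNReal.ofReal (Real.exp (-(r * q))) ∂μ = ENNReal.ofReal (f q) := by
    intro q hq
    have hq' : (0 : ℝ) < q := by exact_mod_cast hq
    have h1 : Tendsto (fun R : ℕ => L (cutoffExp R q)) atTop (𝓝 (f q)) := by
      refine tendsto_of_tendsto_of_tendsto_of_le_of_le ?_ tendsto_const_nhds
        (fun R => hlow R q hq) (fun R => hup R q hq)
      have : Tendsto (fun R : ℕ => Real.exp (-(R * ((q : ℝ) / 2)))) atTop (𝓝 0) :=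
        Real.tendsto_exp_neg_atTop_nhds_zero.comp
          (tendsto_natCast_atTop_atTop.atTop_mul_const (by positivity))
      simpa using (this.mul_const (f (q / 2))).const_sub (f q)
    have h2 : ∀ R : ℕ, ∫⁻ r, ENNReal.ofReal (cutoffExp R q r) ∂μ
        = ENNReal.ofReal (L (cutoffExp R q)) := by
      intro R
      rw [← hint, ofReal_integral_eq_lintegral_ofReal (cutoffExp R q).integrable
        (.of_forall (cutoffExp_nonneg _ _))]
    have h3 : Tendsto (fun R : ℕ => ∫⁻ r, ENNReal.ofReal (cutoffExp R q r) ∂μ) atTop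
        (𝓝 (∫⁻ r, ENNReal.ofReal (Real.exp (-(r * q))) ∂μ)) := by
      refine lintegral_tendsto_of_tendsto_of_monotone
        (fun R => (cutoffExp R q).continuous.measurable.ennreal_ofReal.aemeasurable)
        (.of_forall fun r R R' h => ENNReal.ofReal_le_ofReal
          (cutoffExp_mono _ _ (by exact_mod_cast h))) (.of_forall fun r => ?_)
      refine tendsto_const_nhds.congr' ?_
      filter_upwards [eventually_ge_atTop ⌈(r : ℝ)⌉₊] with R hR
      rw [cutoffExp_eq _ (Nat.ceil_le.1 hR)]
    refine tendsto_nhds_unique h3 ?_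
    simp_rw [h2]
    exact ENNReal.tendsto_ofReal h1
  have hanti : ∀ s t : ℝ, s ≤ t → ∫⁻ r : ℝ≥0, ENNReal.ofReal (Real.exp (-(r * t))) ∂μ ≤
      ∫⁻ r : ℝ≥0, ENNReal.ofReal (Real.exp (-(r * s))) ∂μ := fun s t h =>
    lintegral_mono fun r => ENNReal.ofReal_le_ofReal (by gcongr)
  refine ⟨μ, inferInstance, fun t ht => le_antisymm ?_ ?_⟩
  · obtain ⟨u, -, hu, hut⟩ :=
      (Rat.denseRange_cast (𝕜 := ℝ)).exists_seq_strictMono_tendsto Rat.cast_mono t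
    refine ge_of_tendsto ((ENNReal.continuous_ofReal.tendsto _).comp ((hf t ht).tendsto.comp hut)) ?_
    filter_upwards [hut.eventually (lt_mem_nhds ht)] with n hn
    have := hrat (u n) (Rat.cast_pos.1 hn)
    simp only [Function.comp_apply]
    rw [← this]
    exact hanti _ _ (le_of_lt (hu n))
  · obtain ⟨u, -, hu, hut⟩ :=
      (Rat.denseRange_cast (𝕜 := ℝ)).exists_seq_strictAnti_tendsto Rat.cast_mono t
    refine le_of_tendsto ((ENNReal.continuous_ofReal.tendsto _).comp ((hf t ht).tendsto.comp hut)) ?_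
    filter_upwards with n
    have := hrat (u n) (Rat.cast_pos.1 (ht.trans (hu n)))
    simp only [Function.comp_apply]
    rw [← this]
    exact hanti _ _ (le_of_lt (hu n))

/-- `μ` is a representing measure of the completely monotone function `f`. -/
def IsLaplaceMeasure (μ : Measure ℝ≥0) (f : ℝ → ℝ) : Prop :=
  ∀ t : ℝ, 0 < t → ∫⁻ r, ENNReal.ofReal (Real.exp (-(r * t))) ∂μ = ENNReal.ofReal (f t)

/-- **Bernstein's theorem**: a completely monotone function is the Laplace transform of a
measure. -/
theorem IsCMOn.exists_isLaplaceMeasure {f : ℝ → ℝ} (hf : IsCMOn f) :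
    ∃ μ : Measure ℝ≥0, SigmaFinite μ ∧ IsLaplaceMeasure μ f := by
  obtain ⟨S, hS, hlim⟩ := hf.exists_seq_posFunctional
  exact exists_measure_of_tendsto_posFunctional (fun t ht => hf.continuousAt ht) S hS hlim
lemma ofReal_exp_neg_mul_add (r : ℝ≥0) (s t : ℝ) :
    ENNReal.ofReal (Real.exp (-(r * (s + t)))) =
      ENNReal.ofReal (Real.exp (-(r * s))) * ENNReal.ofReal (Real.exp (-(r * t))) := by
  rw [← ENNReal.ofReal_mul (Real.exp_pos _).le, ← Real.exp_add]
  ring_nf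

/-- A measure on `[0,∞)` with finite Laplace transform is determined by it. -/
theorem measure_ext_of_lintegral_exp_neg_mul {μ ν : Measure ℝ≥0}
    (hfin : ∀ t : ℝ, 0 < t → ∫⁻ r, ENNReal.ofReal (Real.exp (-(r * t))) ∂μ ≠ ⊤)
    (h : ∀ t : ℝ, 0 < t → ∫⁻ r, ENNReal.ofReal (Real.exp (-(r * t))) ∂μ =
      ∫⁻ r, ENNReal.ofReal (Real.exp (-(r * t))) ∂ν) : μ = ν := by
  set w : ℝ≥0 → ℝ≥0∞ := fun r => ENNReal.ofReal (Real.exp (-(r * (1 : ℝ))))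
  have hw : Measurable w := measurable_ofReal_exp_neg_mul 1
  have hwl : ∀ (κ : Measure ℝ≥0) (t : ℝ),
      ∫⁻ r, ENNReal.ofReal (Real.exp (-(r * t))) ∂(κ.withDensity w) =
        ∫⁻ r, ENNReal.ofReal (Real.exp (-(r * (1 + t)))) ∂κ := by
    intro κ t
    rw [lintegral_withDensity_eq_lintegral_mul _ hw (measurable_ofReal_exp_neg_mul t)]
    simp only [ofReal_exp_neg_mul_add, Pi.mul_apply, w]
  have hfinw : ∀ κ : Measure ℝ≥0, ∫⁻ r, w r ∂κ ≠ ⊤ → IsFiniteMeasure (κ.withDensity w) :=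
    fun κ hκ => isFiniteMeasure_withDensity hκ
  have : IsFiniteMeasure (μ.withDensity w) := hfinw μ (hfin 1 one_pos)
  have : IsFiniteMeasure (ν.withDensity w) := hfinw ν (by rw [← h 1 one_pos]; exact hfin 1 one_pos)
  have hinv : ∀ κ : Measure ℝ≥0, (κ.withDensity w).withDensity (fun r => (w r)⁻¹) = κ := fun κ =>
    withDensity_inv_same hw (.of_forall fun r => by simp [w, Real.exp_pos])
      (.of_forall fun r => ENNReal.ofReal_ne_top)
  suffices hs : μ.withDensity w = ν.withDensity w by rw [← hinv μ, hs, hinv ν]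
  let b : BoundedContinuousFunction ℝ≥0 ℝ := BoundedContinuousFunction.ofNormedAddCommGroup
    (fun r : ℝ≥0 => Real.exp (-(r * (1 : ℝ)))) (continuous_exp_neg_mul 1) 1 fun r => by
      rw [Real.norm_eq_abs, Real.abs_exp, Real.exp_le_one_iff]
      simp
  have hb : ∀ r, b r = Real.exp (-(r * (1 : ℝ))) := fun r => rfl
  let A : StarSubalgebra ℝ (BoundedContinuousFunction ℝ≥0 ℝ) :=
    { Algebra.adjoin ℝ {b} with
      star_mem' := fun {g} hg => by
        have : star g = g := by ext; simp
        rw [this]; exact hg }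
  have hbA : b ∈ A := Algebra.subset_adjoin (mem_singleton b)
  refine ext_of_forall_mem_subalgebra_integral_eq_of_polish (𝕜 := ℝ) (A := A) ?_ fun g hg => ?_
  · intro x y hxy
    refine ⟨b, ⟨_, ⟨b, hbA, rfl⟩, rfl⟩, ?_⟩
    rw [hb, hb]
    simpa using hxy
  · obtain ⟨P, rfl⟩ : ∃ P : Polynomial ℝ, Polynomial.aeval b P = g := by
      have : g ∈ Algebra.adjoin ℝ {b} := hg
      rwa [Algebra.adjoin_singleton_eq_range_aeval] at this
    induction P using Polynomial.induction_on' with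
    | add P Q hP hQ =>
      have hP := hP (Polynomial.aeval_mem_adjoin_singleton ℝ b)
      have hQ := hQ (Polynomial.aeval_mem_adjoin_singleton ℝ b)
      simp only [map_add, BoundedContinuousFunction.coe_add, Pi.add_apply]
      rw [integral_add (BoundedContinuousFunction.integrable _ _)
        (BoundedContinuousFunction.integrable _ _), hP, hQ,
        integral_add (BoundedContinuousFunction.integrable _ _)
        (BoundedContinuousFunction.integrable _ _)]
    | monomial n c =>
      have e : ∀ r, (Polynomial.aeval b (Polynomial.monomial n c)) r
          = c * Real.exp (-(r * (n : ℝ))) := by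
        intro r
        rw [Polynomial.aeval_monomial, BoundedContinuousFunction.coe_mul, Pi.mul_apply,
          BoundedContinuousFunction.coe_pow, Pi.pow_apply, hb, ← Real.exp_nat_mul]
        simp [mul_comm, Algebra.algebraMap_eq_smul_one]
      have hI : ∀ κ : Measure ℝ≥0, ∫ r, Real.exp (-(r * (n : ℝ))) ∂(κ.withDensity w) =
          (∫⁻ r, ENNReal.ofReal (Real.exp (-(r * (1 + n : ℝ)))) ∂κ).toReal := fun κ => by
        rw [integral_eq_lintegral_of_nonneg_ae (.of_forall fun r => (Real.exp_pos _).le)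
          (continuous_exp_neg_mul n).aestronglyMeasurable, hwl]
      simp_rw [e]
      rw [integral_const_mul, integral_const_mul, hI, hI, h _ (by positivity)]

lemma IsLaplaceMeasure.integral_eq {μ : Measure ℝ≥0} {f : ℝ → ℝ} (h : IsLaplaceMeasure μ f)
    (hf : IsCMOn f) {t : ℝ} (ht : 0 < t) : ∫ r, Real.exp (-(r * t)) ∂μ = f t := by
  rw [integral_eq_lintegral_of_nonneg_ae (.of_forall fun r => (Real.exp_pos _).le)
    (continuous_exp_neg_mul t).aestronglyMeasurable, h t ht, ENNReal.toReal_ofReal (hf.nonneg ht)]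

/-- A bounded signed density whose Laplace transform is completely monotone is nonnegative. -/
lemma ae_nonneg_of_integral_exp_isCMOn {μ : Measure ℝ≥0}
    (hμ : ∀ t : ℝ, 0 < t → ∫⁻ r, ENNReal.ofReal (Real.exp (-(r * t))) ∂μ ≠ ⊤)
    {g : ℝ≥0 → ℝ} (hg : Measurable g) {M : ℝ} (hM : ∀ᵐ r ∂μ, |g r| ≤ M) {f : ℝ → ℝ}
    (hf : IsCMOn f) (hgf : ∀ t : ℝ, 0 < t → ∫ r, Real.exp (-(r * t)) * g r ∂μ = f t) :
    ∀ᵐ r ∂μ, 0 ≤ g r := by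
  obtain ⟨ν, -, hν⟩ := hf.exists_isLaplaceMeasure
  have hgn : Measurable fun r => -g r := hg.neg
  have hwd : ∀ {k : ℝ≥0 → ℝ}, Measurable k → ∀ t : ℝ,
      ∫⁻ r, ENNReal.ofReal (Real.exp (-(r * t))) ∂(μ.withDensity fun r => ENNReal.ofReal (k r))
        = ∫⁻ r, ENNReal.ofReal (Real.exp (-(r * t)) * k r) ∂μ := fun {k} hk t => by
    rw [lintegral_withDensity_eq_lintegral_mul _ hk.ennreal_ofReal
      (measurable_ofReal_exp_neg_mul t)]
    refine lintegral_congr fun r => ?_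
    rw [Pi.mul_apply, mul_comm, ENNReal.ofReal_mul (Real.exp_pos _).le]
  have hint : ∀ t : ℝ, 0 < t → Integrable (fun r : ℝ≥0 => Real.exp (-(r * t)) * g r) μ := by
    intro t ht
    refine Integrable.mul_bdd (c := M) ?_ hg.aestronglyMeasurable hM
    refine ⟨(continuous_exp_neg_mul t).aestronglyMeasurable, ?_⟩
    rw [hasFiniteIntegral_iff_ofReal (.of_forall fun r => (Real.exp_pos _).le)]
    exact (hμ t ht).lt_top
  have hfinp : ∀ t : ℝ, 0 < t → ∫⁻ r, ENNReal.ofReal (Real.exp (-(r * t)) * g r) ∂μ ≠ ⊤ :=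
    fun t ht => (hint t ht).lintegral_lt_top.ne
  have hfinm : ∀ t : ℝ, 0 < t → ∫⁻ r, ENNReal.ofReal (Real.exp (-(r * t)) * -g r) ∂μ ≠ ⊤ :=
    fun t ht => by
      simpa only [mul_neg] using! (hint t ht).neg.lintegral_lt_top.ne
  have key : μ.withDensity (fun r => ENNReal.ofReal (g r)) =
      μ.withDensity (fun r => ENNReal.ofReal (-g r)) + ν := by
    refine measure_ext_of_lintegral_exp_neg_mul (fun t ht => ?_) fun t ht => ?_
    · rw [hwd hg]; exact hfinp t ht
    · rw [lintegral_add_measure, hwd hg, hwd hgn, hν t ht]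
      have := hgf t ht
      rw [integral_eq_lintegral_pos_part_sub_lintegral_neg_part (hint t ht)] at this
      simp only [neg_mul_eq_mul_neg (Real.exp _)] at this
      have h0 := hf.nonneg ht
      rw [← ENNReal.toReal_eq_toReal_iff' (hfinp t ht)
        (ENNReal.add_ne_top.2 ⟨hfinm t ht, ENNReal.ofReal_ne_top⟩),
        ENNReal.toReal_add (hfinm t ht) ENNReal.ofReal_ne_top, ENNReal.toReal_ofReal h0]
      linarith
  set s : Set ℝ≥0 := {r | g r < 0} with hs
  have h1 : μ.withDensity (fun r => ENNReal.ofReal (g r)) s = 0 := by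
    rw [withDensity_apply_eq_zero' hg.ennreal_ofReal.aemeasurable]
    convert measure_empty (μ := μ)
    ext r
    simp only [mem_inter_iff, mem_ofPred_eq, hs, ne_eq, ENNReal.ofReal_eq_zero, not_le,
      mem_empty_iff_false, iff_false, not_and, not_lt]
    exact fun h => h.le
  rw [key, Measure.add_apply, add_eq_zero,
    withDensity_apply_eq_zero' hgn.ennreal_ofReal.aemeasurable] at h1
  rw [ae_iff]
  refine measure_mono_null (fun r hr => ?_) h1.1
  simp only [mem_ofPred_eq, not_le] at hr
  exact ⟨by simpa using hr, hr⟩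

/-- Tonelli for a Laplace transform: the iterated Laplace transform is the Stieltjes transform. -/
lemma IsLaplaceMeasure.lintegral_exp_mul {μ : Measure ℝ≥0} [SigmaFinite μ] {q : ℝ → ℝ}
    (hμ : IsLaplaceMeasure μ q) {p : ℝ} (hp : 0 < p) :
    ∫⁻ t in Ioi (0 : ℝ), ENNReal.ofReal (Real.exp (-p * t) * q t) =
      ∫⁻ r, ENNReal.ofReal ((p + r)⁻¹) ∂μ := by
  have h1 : ∀ t ∈ Ioi (0 : ℝ), ENNReal.ofReal (Real.exp (-p * t) * q t) =
      ∫⁻ r, ENNReal.ofReal (Real.exp (-(p + r) * t)) ∂μ := fun t ht => by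
    rw [ENNReal.ofReal_mul (Real.exp_pos _).le, ← hμ t ht,
      ← lintegral_const_mul _ (measurable_ofReal_exp_neg_mul t)]
    refine lintegral_congr fun r => ?_
    rw [← ENNReal.ofReal_mul (Real.exp_pos _).le, ← Real.exp_add]
    ring_nf
  have hm : Measurable (Function.uncurry fun (t : ℝ) (r : ℝ≥0) =>
      ENNReal.ofReal (Real.exp (-(p + r) * t))) :=
    ENNReal.measurable_ofReal.comp (Continuous.measurable (by fun_prop))
  rw [setLIntegral_congr_fun measurableSet_Ioi h1, lintegral_lintegral_swap hm.aemeasurable]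
  refine lintegral_congr fun r => ?_
  have hpr : 0 < p + r := by positivity
  rw [← ofReal_integral_eq_lintegral_ofReal (exp_neg_integrableOn_Ioi 0 hpr)
    (.of_forall fun t => (Real.exp_pos _).le), integral_exp_mul_Ioi (by linarith)]
  congr 1
  simp only [mul_zero, Real.exp_zero]
  rw [neg_div_neg_eq, one_div]

section ScalarBernstein

variable {a q : ℝ → ℝ}

lemma monotoneOn_of_hasDerivAt_isCMOn (hd : ∀ t, 0 < t → HasDerivAt a (q t) t)
    (hq : IsCMOn q) : MonotoneOn a (Ioi 0) :=
  monotoneOn_of_deriv_nonneg (convex_Ioi 0)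
    (fun t ht => (hd t ht).continuousAt.continuousWithinAt)
    (fun t ht => (hd t (interior_subset ht)).differentiableAt.differentiableWithinAt)
    fun t ht => by
      rw [(hd t (interior_subset ht)).deriv]
      exact hq.nonneg (interior_subset ht)

lemma exists_tendsto_nhdsGT_zero (ha : ∀ t, 0 < t → 0 ≤ a t)
    (hd : ∀ t, 0 < t → HasDerivAt a (q t) t) (hq : IsCMOn q) :
    ∃ c, Tendsto a (𝓝[>] 0) (𝓝 c) :=
  ⟨_, (monotoneOn_of_hasDerivAt_isCMOn hd hq).tendsto_nhdsGT
    ⟨0, by rintro _ ⟨t, ht, rfl⟩; exact ha t ht⟩⟩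

/-- A nonnegative Bernstein function grows at most linearly. -/
lemma le_add_mul_of_hasDerivAt_isCMOn (hd : ∀ t, 0 < t → HasDerivAt a (q t) t)
    (hq : IsCMOn q) {t : ℝ} (ht : 0 < t) : a t ≤ a 1 + q 1 * t := by
  have hq1 := hq.nonneg one_pos
  rcases le_or_gt t 1 with h1 | h1
  · have := monotoneOn_of_hasDerivAt_isCMOn hd hq ht (mem_Ioi.2 one_pos) h1
    nlinarith
  · obtain ⟨x, hx, hxe⟩ := exists_hasDerivAt_eq_slope a q h1
      (fun y hy => (hd y (one_pos.trans_le hy.1)).continuousAt.continuousWithinAt)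
      fun y hy => hd y (one_pos.trans hy.1)
    have hx1 : q x ≤ q 1 :=
      hq.antitoneOn (mem_Ioi.2 one_pos) (mem_Ioi.2 (one_pos.trans hx.1)) hx.1.le
    rw [hxe, div_le_iff₀ (by linarith)] at hx1
    linarith

lemma exists_exp_neg_mul_le (ha : ∀ t, 0 < t → 0 ≤ a t)
    (hd : ∀ t, 0 < t → HasDerivAt a (q t) t) (hq : IsCMOn q) {p : ℝ} (hp : 0 < p) :
    ∃ K, ∀ t, 0 < t → ‖Real.exp (-p * t) * a t‖ ≤ K * Real.exp (-(p / 2) * t) := by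
  refine ⟨a 1 + 2 * q 1 / p, fun t ht => ?_⟩
  have hq1 := hq.nonneg one_pos
  have ha1 := ha 1 one_pos
  have hle := le_add_mul_of_hasDerivAt_isCMOn hd hq ht
  have he : p / 2 * t + 1 ≤ Real.exp (p / 2 * t) := Real.add_one_le_exp _
  have hsplit : Real.exp (-p * t) * Real.exp (p / 2 * t) = Real.exp (-(p / 2) * t) := by
    rw [← Real.exp_add]; ring_nf
  rw [Real.norm_of_nonneg (mul_nonneg (Real.exp_pos _).le (ha t ht)), ← hsplit]
  have : a t ≤ (a 1 + 2 * q 1 / p) * Real.exp (p / 2 * t) := by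
    have h0 : 0 ≤ a 1 + 2 * q 1 / p := by positivity
    have h1 := mul_le_mul_of_nonneg_left he h0
    have h2 : 2 * q 1 / p * (p / 2 * t) = q 1 * t := by field_simp
    have h3 : 0 ≤ a 1 * (p / 2 * t) := by positivity
    have h4 : 0 ≤ 2 * q 1 / p := by positivity
    nlinarith
  calc _ ≤ Real.exp (-p * t) * ((a 1 + 2 * q 1 / p) * Real.exp (p / 2 * t)) := by gcongr
    _ = _ := by ring

lemma integrableOn_exp_neg_mul (ha : ∀ t, 0 < t → 0 ≤ a t)
    (hd : ∀ t, 0 < t → HasDerivAt a (q t) t) (hq : IsCMOn q) {p : ℝ} (hp : 0 < p) :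
    IntegrableOn (fun t => Real.exp (-p * t) * a t) (Ioi 0) := by
  obtain ⟨K, hK⟩ := exists_exp_neg_mul_le ha hd hq hp
  refine Integrable.mono' ((exp_neg_integrableOn_Ioi 0 (half_pos hp)).const_mul K) ?_
    ((ae_restrict_iff' measurableSet_Ioi).2 (.of_forall fun t ht => hK t ht))
  refine ContinuousOn.aestronglyMeasurable (fun t ht => ?_) measurableSet_Ioi
  have := (hd t ht).continuousAt
  exact ContinuousAt.continuousWithinAt (by fun_prop)

lemma integrableOn_exp_neg_mul_deriv (ha : ∀ t, 0 < t → 0 ≤ a t)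
    (hd : ∀ t, 0 < t → HasDerivAt a (q t) t) (hq : IsCMOn q) {p : ℝ} (hp : 0 < p) :
    IntegrableOn (fun t => Real.exp (-p * t) * q t) (Ioi 0) := by
  obtain ⟨c, hc⟩ := exists_tendsto_nhdsGT_zero ha hd hq
  have hqc : ContinuousOn q (Ioi 0) := fun t ht => (hq.continuousAt ht).continuousWithinAt
  have h1 : IntegrableOn q (Ioc 0 1) := by
    refine intervalIntegral.integrableOn_deriv_of_nonneg (g := Function.update a 0 c)
      (continuousOn_update_iff.2 ⟨fun t ht => ?_, fun _ => hc.mono_left ?_⟩) (fun t ht => ?_)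
      fun t ht => hq.nonneg ht.1
    · exact (hd t (lt_of_le_of_ne ht.1.1 (Ne.symm ht.2))).continuousAt.continuousWithinAt
    · exact nhdsWithin_mono _ fun t ht => lt_of_le_of_ne ht.1.1 (Ne.symm ht.2)
    · refine (hd t ht.1).congr_of_eventuallyEq ?_
      filter_upwards [Ioi_mem_nhds ht.1] with s hs
      exact Function.update_of_ne (ne_of_gt hs) _ _
  rw [← Ioc_union_Ioi_eq_Ioi zero_le_one]
  refine IntegrableOn.union ?_ ?_
  · refine Integrable.mono' h1 ((Continuous.aestronglyMeasurable (by fun_prop)).mul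
      h1.aestronglyMeasurable) ((ae_restrict_iff' measurableSet_Ioc).2 (.of_forall fun t ht => ?_))
    have hq0 := hq.nonneg ht.1
    rw [Real.norm_of_nonneg (mul_nonneg (Real.exp_pos _).le hq0)]
    refine mul_le_of_le_one_left hq0 (Real.exp_le_one_iff.2 ?_)
    nlinarith [ht.1]
  · refine Integrable.mono' ((exp_neg_integrableOn_Ioi 1 hp).mul_const (q 1))
      (ContinuousOn.aestronglyMeasurable ?_ measurableSet_Ioi)
      ((ae_restrict_iff' measurableSet_Ioi).2 (.of_forall fun t ht => ?_))
    · exact ContinuousOn.mul (by fun_prop) (hqc.mono (Ioi_subset_Ioi zero_le_one))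
    · have ht0 : (0 : ℝ) < t := one_pos.trans ht
      rw [Real.norm_of_nonneg (mul_nonneg (Real.exp_pos _).le (hq.nonneg ht0))]
      gcongr
      exact hq.antitoneOn (mem_Ioi.2 one_pos) ht0 (le_of_lt ht)

lemma mul_integral_exp_neg_mul (ha : ∀ t, 0 < t → 0 ≤ a t)
    (hd : ∀ t, 0 < t → HasDerivAt a (q t) t) (hq : IsCMOn q) {c : ℝ}
    (hc : Tendsto a (𝓝[>] 0) (𝓝 c)) {p : ℝ} (hp : 0 < p) :
    p * ∫ t in Ioi (0 : ℝ), Real.exp (-p * t) * a t =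
      c + ∫ t in Ioi (0 : ℝ), Real.exp (-p * t) * q t := by
  have hu : ∀ t ∈ Ioi (0 : ℝ), HasDerivAt (fun t => Real.exp (-p * t))
      (Real.exp (-p * t) * -p) t := fun t _ => by
    simpa using ((hasDerivAt_id t).const_mul (-p)).exp
  have hI : IntegrableOn ((fun t => Real.exp (-p * t) * -p) * a) (Ioi 0) := by
    have := (integrableOn_exp_neg_mul ha hd hq hp).const_mul (-p)
    refine this.congr (.of_forall fun t => ?_)
    simp only [Pi.mul_apply]
    ring
  have h0 : Tendsto ((fun t => Real.exp (-p * t)) * a) (𝓝[>] 0) (𝓝 c) := by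
    have : Tendsto (fun t => Real.exp (-p * t)) (𝓝[>] 0) (𝓝 1) :=
      (Continuous.tendsto' (by fun_prop) 0 1 (by simp)).mono_left nhdsWithin_le_nhds
    simpa using! this.mul hc
  have hinf : Tendsto ((fun t => Real.exp (-p * t)) * a) atTop (𝓝 0) := by
    obtain ⟨K, hK⟩ := exists_exp_neg_mul_le ha hd hq hp
    have hexp : Tendsto (fun t => K * Real.exp (-(p / 2) * t)) atTop (𝓝 0) := by
      simpa using ((Real.tendsto_exp_atBot.comp (tendsto_id.const_mul_atTop_of_neg
        (show -(p / 2) < 0 by linarith))).const_mul K)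
    refine squeeze_zero_norm' ?_ hexp
    filter_upwards [eventually_gt_atTop 0] with t ht using hK t ht
  have := integral_Ioi_mul_deriv_eq_deriv_mul hu (fun t ht => hd t ht)
    (integrableOn_exp_neg_mul_deriv ha hd hq hp) hI h0 hinf
  rw [this, ← integral_const_mul]
  have e : ∀ t, Real.exp (-p * t) * -p * a t = -(p * (Real.exp (-p * t) * a t)) := fun t => by ring
  simp only [e, integral_neg]
  ring

/-- The Laplace transform of a nonnegative Bernstein function `a` with representing measure `μ`
of `a'` satisfies `p * L a p = a (0+) + ∫ (p + r)⁻¹ dμ`. -/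
lemma mul_integral_exp_neg_mul_eq_add_integral (ha : ∀ t, 0 < t → 0 ≤ a t)
    (hd : ∀ t, 0 < t → HasDerivAt a (q t) t) (hq : IsCMOn q) {c : ℝ}
    (hc : Tendsto a (𝓝[>] 0) (𝓝 c)) {μ : Measure ℝ≥0} [SigmaFinite μ]
    (hμ : IsLaplaceMeasure μ q) {p : ℝ} (hp : 0 < p) :
    ∫⁻ r, ENNReal.ofReal ((p + r)⁻¹) ∂μ ≠ ⊤ ∧
    p * ∫ t in Ioi (0 : ℝ), Real.exp (-p * t) * a t = c + ∫ r, (p + r : ℝ)⁻¹ ∂μ := by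
  have hI := integrableOn_exp_neg_mul_deriv ha hd hq hp
  have h0 : ∀ᵐ t ∂(volume.restrict (Ioi (0 : ℝ))), 0 ≤ Real.exp (-p * t) * q t :=
    (ae_restrict_iff' measurableSet_Ioi).2
      (.of_forall fun t ht => mul_nonneg (Real.exp_pos _).le (hq.nonneg ht))
  refine ⟨?_, ?_⟩
  · rw [← hμ.lintegral_exp_mul hp]
    exact hI.lintegral_lt_top.ne
  · rw [mul_integral_exp_neg_mul ha hd hq hc hp, integral_eq_lintegral_of_nonneg_ae h0
      hI.aestronglyMeasurable, hμ.lintegral_exp_mul hp, integral_eq_lintegral_of_nonneg_ae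
      (.of_forall fun r => by simp only [Pi.zero_apply]; positivity)
      (Measurable.aestronglyMeasurable (by fun_prop))]

end ScalarBernstein

section Polarization

variable {ι : Type*}

/-- Polarization: recovers a symmetric bilinear form `b` from the values
`x i j = b (e i + e j) (e i + e j)`. -/
def polarization (x : ι → ι → ℝ) (i j : ι) : ℝ :=
  (x i j - x i i / 4 - x j j / 4) / 2

lemma polarization_comm {x : ι → ι → ℝ} (h : ∀ i j, x i j = x j i) (i j : ι) :
    polarization x i j = polarization x j i := by
  simp only [polarization, h i j]
  ring

lemma mul_polarization (k : ℝ) (x : ι → ι → ℝ) (i j : ι) :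
    k * polarization x i j = polarization (fun i j => k * x i j) i j := by
  simp only [polarization]
  ring

lemma polarization_add (x y : ι → ι → ℝ) (i j : ι) :
    polarization (fun i j => x i j + y i j) i j = polarization x i j + polarization y i j := by
  simp only [polarization]
  ring

lemma abs_polarization_le {x : ι → ι → ℝ} (h : ∀ i j, |x i j| ≤ 1) (i j : ι) :
    |polarization x i j| ≤ 1 := by
  have h1 := abs_le.1 (h i j)
  have h2 := abs_le.1 (h i i)
  have h3 := abs_le.1 (h j j)
  rw [polarization, abs_le]
  constructor <;> linarith

lemma integral_polarization {α : Type*} [MeasurableSpace α] {μ : Measure α} {f : α → ι → ι → ℝ}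
    (hf : ∀ i j, Integrable (fun x => f x i j) μ) (i j : ι) :
    ∫ x, polarization (f x) i j ∂μ = polarization (fun i j => ∫ x, f x i j ∂μ) i j := by
  simp only [polarization]
  have h := fun i => (hf i i).div_const 4
  rw [integral_div, integral_sub (f := fun x => f x i j - f x i i / 4) ((hf i j).sub (h i)) (h j),
    integral_sub (hf i j) (h i), integral_div, integral_div]

lemma tendsto_polarization {α : Type*} {l : Filter α} {f : α → ι → ι → ℝ} {x : ι → ι → ℝ}
    (h : ∀ i j, Tendsto (fun a => f a i j) l (𝓝 (x i j))) (i j : ι) :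
    Tendsto (fun a => polarization (f a) i j) l (𝓝 (polarization x i j)) :=
  (((h i j).sub ((h i i).div_const 4)).sub ((h j j).div_const 4)).div_const 2

variable [Fintype ι]

lemma dotProduct_mulVec_eq_sum (M : Matrix ι ι ℝ) (v w : ι → ℝ) :
    v ⬝ᵥ M *ᵥ w = ∑ i, ∑ j, v i * w j * M i j := by
  simp only [dotProduct, mulVec, Finset.mul_sum]
  exact Finset.sum_congr rfl fun i _ => Finset.sum_congr rfl fun j _ => by ring

lemma polarization_quadForm [DecidableEq ι] {M : Matrix ι ι ℝ} (hM : M.IsSymm) (i j : ι) :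
    polarization (fun i j => (Pi.single i 1 + Pi.single j 1) ⬝ᵥ
      M *ᵥ (Pi.single i 1 + Pi.single j 1)) i j = M i j := by
  have h := hM.apply i j
  simp only [polarization, mulVec_add, dotProduct_add, add_dotProduct, mulVec_single_one,
    single_one_dotProduct, col_apply]
  rw [h]
  ring

end Polarization

lemma posSemidef_of_tendsto {ι α : Type*} [Fintype ι] {l : Filter α} [l.NeBot]
    {F : α → Matrix ι ι ℝ} {C : Matrix ι ι ℝ} (hF : ∀ᶠ a in l, (F a).PosSemidef)
    (h : ∀ i j, Tendsto (fun a => F a i j) l (𝓝 (C i j))) : C.PosSemidef := by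
  refine .of_dotProduct_mulVec_nonneg ?_ fun v => ?_
  · ext i j
    refine tendsto_nhds_unique (h j i) ((h i j).congr' ?_)
    filter_upwards [hF] with a ha
    simpa using (ha.1.apply i j).symm
  · have : Tendsto (fun a => star v ⬝ᵥ F a *ᵥ v) l (𝓝 (star v ⬝ᵥ C *ᵥ v)) := by
      simp only [dotProduct_mulVec_eq_sum]
      exact tendsto_finsetSum _ fun i _ => tendsto_finsetSum _ fun j _ => (h i j).const_mul _
    refine ge_of_tendsto this ?_
    filter_upwards [hF] with a ha using ha.dotProduct_mulVec_nonneg v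

/-- Positive semidefiniteness of a symmetric matrix can be tested on rational vectors. -/
lemma posSemidef_of_forall_rat {ι : Type*} [Fintype ι] {M : Matrix ι ι ℝ} (hM : M.IsSymm)
    (h : ∀ v : ι → ℚ, 0 ≤ ∑ i, ∑ j, (v i : ℝ) * (v j : ℝ) * M i j) : M.PosSemidef := by
  refine .of_dotProduct_mulVec_nonneg (by simpa [IsHermitian] using! hM) fun v => ?_
  rw [star_trivial]
  have hd : DenseRange fun (v : ι → ℚ) i => (v i : ℝ) :=
    DenseRange.piMap fun _ => Rat.denseRange_cast
  refine hd.induction_on (p := fun v => 0 ≤ v ⬝ᵥ M *ᵥ v) v ?_ fun w => ?_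
  · simp only [dotProduct_mulVec_eq_sum]
    exact isClosed_le continuous_const (by fun_prop)
  · simpa only [dotProduct_mulVec_eq_sum] using h w

/-- A Stieltjes representation over `ℝ≥0` gives one over `ℝ`. -/
lemma isStieltjesM_of_nnreal {m : ℕ} {Y : ℝ → Matrix (Fin m) (Fin m) ℝ}
    {C : Matrix (Fin m) (Fin m) ℝ} {μ : Measure ℝ≥0} {G : ℝ≥0 → Matrix (Fin m) (Fin m) ℝ} {M : ℝ}
    (hC : C.PosSemidef) (hμ : ∫⁻ r, ENNReal.ofReal ((1 + r : ℝ)⁻¹) ∂μ < ⊤)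
    (hG : ∀ i j, Measurable fun r => G r i j) (hpsd : ∀ᵐ r ∂μ, (G r).PosSemidef)
    (hM : ∀ᵐ r ∂μ, ∀ i j, |G r i j| ≤ M)
    (hY : ∀ p > 0, ∀ i j, Y p i j = C i j + ∫ r, (p + r : ℝ)⁻¹ * G r i j ∂μ) :
    IsStieltjesM m Y := by
  have he : MeasurableEmbedding ((↑) : ℝ≥0 → ℝ) :=
    MeasurableEmbedding.subtype_coe measurableSet_Ici
  have h0 : μ.map ((↑) : ℝ≥0 → ℝ) (Iio 0) = 0 := by
    rw [he.map_apply]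
    convert measure_empty (μ := μ)
    ext r
    simp
  have hr : (μ.map ((↑) : ℝ≥0 → ℝ)).restrict (Ici 0) = μ.map (↑) :=
    Measure.restrict_eq_self_of_ae_mem (he.ae_map_iff.2 (.of_forall fun r => r.2))
  refine ⟨C, μ.map (↑), fun r => G r.toNNReal, hC, h0, ?_,
    fun i j => (hG i j).comp measurable_real_toNNReal, ?_, ⟨M, ?_⟩, fun p hp => ?_⟩
  · rwa [hr, he.lintegral_map]
  · rw [he.ae_map_iff]
    simpa using hpsd
  · rw [he.ae_map_iff]
    simpa using hM
  · ext i j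
    rw [hY p hp, hr]
    simp only [Matrix.add_apply, of_apply, he.integral_map, Real.toNNReal_coe]

/-- If `A : (0,∞) → S₊` is an `S₊`-valued Bernstein function, then
`p ↦ p·Ã(p)`, where `Ã` is the Laplace transform of `A`, is an `S₊`-valued Stieltjes
function on `(0,∞)`. -/
theorem p_laplace_isStieltjes_of_bernstein (m : ℕ) (A : ℝ → Matrix (Fin m) (Fin m) ℝ)
    (hA : MatBernstein m A) (hpsd : ∀ t ∈ Set.Ioi (0:ℝ), (A t).PosSemidef) :
    IsStieltjesM m (fun p => p • matLaplace m A p) := by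
  
  have hsymm : ∀ t, 0 < t → (A t).IsSymm := fun t ht => by
    simpa [IsHermitian] using! (hpsd t ht).1
  have hentry : ∀ i j t, 0 < t → HasDerivAt (fun s => A s i j) (matDeriv m A t i j) t :=
    fun i j t ht => ((hA.1 i j).differentiableAt (Ioi_mem_nhds ht)).hasDerivAt
  have hdsymm : ∀ t, 0 < t → (matDeriv m A t).IsSymm := fun t ht => by
    ext i j
    refine (hentry j i t ht).unique ((hentry i j t ht).congr_of_eventuallyEq ?_)
    filter_upwards [Ioi_mem_nhds ht] with s hs using (hsymm s hs).apply i j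
  set a : (Fin m → ℝ) → ℝ → ℝ := fun v t => v ⬝ᵥ (A t).mulVec v
  set q : (Fin m → ℝ) → ℝ → ℝ := fun v t => v ⬝ᵥ (matDeriv m A t).mulVec v
  have hq : ∀ v, IsCMOn (q v) := fun v => by
    refine ⟨?_, fun n t ht => hA.2.2 v n t ht⟩
    simp only [q, dotProduct_mulVec_eq_sum]
    exact ContDiffOn.sum fun i _ => ContDiffOn.sum fun j _ => contDiffOn_const.mul (hA.2.1 i j)
  have ha : ∀ v t, 0 < t → 0 ≤ a v t := fun v t ht => by
    simpa using (hpsd t ht).dotProduct_mulVec_nonneg v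
  have hd : ∀ v t, 0 < t → HasDerivAt (a v) (q v t) t := fun v t ht => by
    simp only [a, q, dotProduct_mulVec_eq_sum]
    exact HasDerivAt.fun_sum fun i _ => HasDerivAt.fun_sum fun j _ => (hentry i j t ht).const_mul _
  choose c hc using fun v => exists_tendsto_nhdsGT_zero (ha v) (hd v) (hq v)
  choose ν hσ hν using fun v => (hq v).exists_isLaplaceMeasure
  have hlap := fun v p (hp : 0 < p) =>
    mul_integral_exp_neg_mul_eq_add_integral (ha v) (hd v) (hq v) (hc v) (hν v) hp
  let E : Fin m → Fin m → Fin m → ℝ := fun i j => Pi.single i 1 + Pi.single j 1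
  have hE : ∀ i j, E i j = E j i := fun i j => add_comm _ _
  have hpol : ∀ t, 0 < t → ∀ i j, polarization (fun i j => a (E i j) t) i j = A t i j :=
    fun t ht => polarization_quadForm (hsymm t ht)
  have hdpol : ∀ t, 0 < t → ∀ i j, polarization (fun i j => q (E i j) t) i j = matDeriv m A t i j :=
    fun t ht => polarization_quadForm (hdsymm t ht)
  set μ : Measure ℝ≥0 := Measure.sum fun ij : Fin m × Fin m => ν (E ij.1 ij.2) with hμ
  have hle : ∀ i j, ν (E i j) ≤ μ := fun i j =>
    Measure.le_sum (fun ij : Fin m × Fin m => ν (E ij.1 ij.2)) (i, j)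
  have hac : ∀ i j, ν (E i j) ≪ μ := fun i j => Measure.absolutelyContinuous_of_le (hle i j)
  have hμfin : ∀ f : ℝ≥0 → ℝ≥0∞, (∀ i j, ∫⁻ r, f r ∂(ν (E i j)) ≠ ⊤) → ∫⁻ r, f r ∂μ < ⊤ :=
    fun f hf => by
      rw [hμ, lintegral_sum_measure, tsum_fintype]
      exact ENNReal.sum_lt_top.2 fun ij _ => (hf _ _).lt_top
  have hμexp : ∀ t : ℝ, 0 < t → ∫⁻ r, ENNReal.ofReal (Real.exp (-(r * t))) ∂μ ≠ ⊤ := fun t ht =>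
    (hμfin _ fun i j => by rw [hν _ t ht]; exact ENNReal.ofReal_ne_top).ne
  have hμst : ∀ p : ℝ, 0 < p → ∫⁻ r, ENNReal.ofReal ((p + r : ℝ)⁻¹) ∂μ < ⊤ := fun p hp =>
    hμfin _ fun i j => (hlap _ p hp).1
  let g : Fin m → Fin m → ℝ≥0 → ℝ := fun i j r => ((ν (E i j)).rnDeriv μ r).toReal
  have hgm : ∀ i j, Measurable (g i j) := fun i j => (Measure.measurable_rnDeriv _ _).ennreal_toReal
  have hg1 : ∀ᵐ r ∂μ, ∀ i j, |g i j r| ≤ 1 := by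
    simp only [ae_all_iff]
    intro i j
    filter_upwards [Measure.rnDeriv_le_one_of_le (hle i j)] with r hr
    rw [abs_of_nonneg ENNReal.toReal_nonneg]
    exact ENNReal.toReal_le_of_le_ofReal zero_le_one (by simpa using hr)
  let G : ℝ≥0 → Matrix (Fin m) (Fin m) ℝ := fun r => of (polarization fun i j => g i j r)
  have hGm : ∀ i j, Measurable fun r => G r i j := fun i j =>
    (((hgm i j).sub ((hgm i i).div_const 4)).sub ((hgm j j).div_const 4)).div_const 2
  have hG1 : ∀ᵐ r ∂μ, ∀ i j, |G r i j| ≤ 1 := by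
    filter_upwards [hg1] with r hr using abs_polarization_le hr
  have hGint : ∀ k : ℝ≥0 → ℝ, Integrable k μ → ∀ i j,
      ∫ r, k r * G r i j ∂μ = polarization (fun i j => ∫ r, k r ∂(ν (E i j))) i j := by
    intro k hk i j
    simp only [G, of_apply, mul_polarization]
    rw [integral_polarization fun i j => hk.mul_bdd (c := 1) (hgm i j).aestronglyMeasurable
      (hg1.mono fun r hr => hr i j)]
    congr! 3 with i j
    rw [← integral_rnDeriv_smul (hac i j)]
    simp only [smul_eq_mul, mul_comm, g]
  have hint : ∀ k : ℝ≥0 → ℝ, Measurable k → (∀ r, 0 ≤ k r) →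
      ∫⁻ r, ENNReal.ofReal (k r) ∂μ < ⊤ → Integrable k μ := fun k hk h0 hfin =>
    ⟨hk.aestronglyMeasurable, (hasFiniteIntegral_iff_ofReal (.of_forall h0)).2 hfin⟩
  have hGexp : ∀ t, 0 < t → ∀ i j, ∫ r, Real.exp (-(r * t)) * G r i j ∂μ = matDeriv m A t i j := by
    intro t ht i j
    rw [hGint _ (hint _ (continuous_exp_neg_mul t).measurable (fun r => (Real.exp_pos _).le)
      (hμexp t ht).lt_top), ← hdpol t ht]
    simp only [(hν _).integral_eq (hq _) ht]
  refine isStieltjesM_of_nnreal (C := of (polarization fun i j => c (E i j))) (μ := μ) (G := G)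
    (M := 1) ?_ (hμst 1 one_pos) hGm ?_ hG1 fun p hp i j => ?_
  · refine posSemidef_of_tendsto (l := 𝓝[>] 0) (F := A) ?_ fun i j => ?_
    · filter_upwards [self_mem_nhdsWithin] with t ht using hpsd t ht
    · refine (tendsto_polarization (fun i j => hc (E i j)) i j).congr' ?_
      filter_upwards [self_mem_nhdsWithin] with t ht using hpol t ht i j
  · have : ∀ᵐ r ∂μ, ∀ v : Fin m → ℚ, 0 ≤ ∑ i, ∑ j, (v i : ℝ) * (v j : ℝ) * G r i j := by
      rw [ae_all_iff]
      intro v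
      refine ae_nonneg_of_integral_exp_isCMOn hμexp
        (M := ∑ i, ∑ j, |(v i : ℝ) * (v j : ℝ)|) ?_ ?_ (hq fun i => (v i : ℝ)) fun t ht => ?_
      · exact Finset.measurable_fun_sum _ fun i _ => Finset.measurable_fun_sum _ fun j _ =>
          (hGm i j).const_mul _
      · filter_upwards [hG1] with r hr
        refine (Finset.abs_sum_le_sum_abs _ _).trans (Finset.sum_le_sum fun i _ =>
          (Finset.abs_sum_le_sum_abs _ _).trans (Finset.sum_le_sum fun j _ => ?_))
        rw [abs_mul]
        exact mul_le_of_le_one_right (abs_nonneg _) (hr i j)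
      · have hI : ∀ i j, Integrable (fun r : ℝ≥0 =>
            (v i : ℝ) * (v j : ℝ) * (Real.exp (-(r * t)) * G r i j)) μ := fun i j =>
          ((hint _ (continuous_exp_neg_mul t).measurable (fun r => (Real.exp_pos _).le)
            (hμexp t ht).lt_top).mul_bdd (c := 1) (hGm i j).aestronglyMeasurable
            (hG1.mono fun r hr => hr i j)).const_mul _
        simp only [q, dotProduct_mulVec_eq_sum, Finset.mul_sum, mul_left_comm (Real.exp _)]
        rw [integral_finsetSum _ fun i _ => integrable_finsetSum _ fun j _ => hI i j]
        refine Finset.sum_congr rfl fun i _ => ?_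
        rw [integral_finsetSum _ fun j _ => hI i j]
        refine Finset.sum_congr rfl fun j _ => ?_
        rw [integral_const_mul, hGexp t ht]
    filter_upwards [this] with r hr
    refine posSemidef_of_forall_rat (IsSymm.ext fun i j => ?_) hr
    exact polarization_comm (x := fun i j => g i j r) (fun i j => by simp only [g, hE i j]) j i
  · have hk : Integrable (fun r : ℝ≥0 => (p + r : ℝ)⁻¹) μ :=
      hint _ (by fun_prop) (fun r => by positivity) (hμst p hp)
    rw [hGint _ hk, of_apply, ← polarization_add]
    simp only [← (hlap _ p hp).2, Matrix.smul_apply, matLaplace, of_apply, smul_eq_mul]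
    rw [← mul_polarization, ← integral_polarization fun i j =>
      integrableOn_exp_neg_mul (ha _) (hd _) (hq _) hp]
    congr 1
    refine setIntegral_congr_fun measurableSet_Ioi fun t ht => ?_
    simp only [← hpol t ht i j, mul_polarization]
end
end

section
/- Every S₊-valued locally integrable completely monotone (LICM) function A : (0,∞) → S₊ admits an integral representation: there exist a Borel measure μ on [0,∞) satisfying ∫_{[0,∞)} (1 + r)^{−1} μ(dr) < ∞ and a measurable S₊-valued function G on [0,∞), bounded everywhere except possibly on a set of μ-measure zero, such that A(t) = ∫_{[0,∞)} e^{−rt} G(r) μ(dr) for all t > 0; consequently the Laplace transform of A satisfies Ã(p) = ∫_{[0,∞)} (p + r)^{−1} G(r) μ(dr) for all p > 0. -/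
open MeasureTheory Set Filter Topology Matrix

noncomputable section

theorem cast_descFactorial_eq_prod (k j : ℕ) :
    (k.descFactorial j : ℝ) = ∏ i ∈ Finset.range j, ((k : ℝ) - i) := by
  induction j with
  | zero => simp
  | succ j ih =>
    rw [Nat.descFactorial_succ, Finset.prod_range_succ, ← ih]
    rcases le_or_gt j k with h | h
    · push_cast [h]; ring
    · simp [Nat.descFactorial_of_lt h]

theorem descFactorial_smul_X_pow (j n : ℕ) (hj : j ≤ n) :
    ∑ k ∈ Finset.range (n + 1), ((n.choose k : ℝ) * k.descFactorial j) •
      (Polynomial.X ^ k * (1 - Polynomial.X) ^ (n - k) : Polynomial ℝ) =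
      (n.descFactorial j : ℝ) • Polynomial.X ^ j := by
  obtain ⟨N, rfl⟩ := Nat.exists_eq_add_of_le hj
  rw [add_assoc, Finset.sum_range_add, Finset.sum_eq_zero, zero_add]
  · have key : ∀ i ∈ Finset.range (N + 1),
        (((j + N).choose (j + i) : ℝ) * (j + i).descFactorial j) •
          (Polynomial.X ^ (j + i) * (1 - Polynomial.X) ^ (j + N - (j + i)) : Polynomial ℝ) =
        ((j + N).descFactorial j : ℝ) • (Polynomial.X ^ j *
          (Polynomial.X ^ i * (1 - Polynomial.X) ^ (N - i) * (N.choose i : Polynomial ℝ))) := by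
      intro i hi
      have h1 : (j + N).choose (j + i) * (j + i).descFactorial j =
          (j + N).descFactorial j * N.choose i := by
        have := @Nat.choose_mul (j + N) (j + i) j (by omega)
        rw [Nat.descFactorial_eq_factorial_mul_choose, Nat.descFactorial_eq_factorial_mul_choose]
        simp only [Nat.add_sub_cancel_left] at this
        linear_combination (j.factorial) * this
      have h2 : j + N - (j + i) = N - i := by omega
      rw [h2, ← Nat.cast_mul, h1]
      simp only [Polynomial.smul_eq_C_mul]
      push_cast
      simp only [map_mul, map_natCast]
      ring
    rw [Finset.sum_congr rfl key, ← Finset.smul_sum, ← Finset.mul_sum, ← add_pow]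
    simp
  · intro k hk
    simp [Nat.descFactorial_of_lt (Finset.mem_range.1 hk)]

/-- The linear functional on polynomials with prescribed values on monomials. -/
def momentFunctional (c : ℕ → ℝ) : Polynomial ℝ →ₗ[ℝ] ℝ :=
  (Polynomial.basisMonomials ℝ).constr ℝ c

@[simp] theorem momentFunctional_X_pow (c : ℕ → ℝ) (k : ℕ) :
    momentFunctional c (Polynomial.X ^ k) = c k := by
  have := (Polynomial.basisMonomials ℝ).constr_basis ℝ c k
  rw [Polynomial.coe_basisMonomials] at this
  rwa [momentFunctional, ← Polynomial.monomial_one_right_eq_X_pow]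

/-- The point `k / n` clipped to the unit interval. -/
def gridPoint (n k : ℕ) : unitInterval := projIcc 0 1 zero_le_one ((k : ℝ) / n)

theorem coe_gridPoint {n k : ℕ} (h : k ≤ n) : (gridPoint n k : ℝ) = k / n := by
  rw [gridPoint, projIcc_of_mem zero_le_one (x := (k : ℝ) / n)]
  exact ⟨by positivity, div_le_one_of_le₀ (by exact_mod_cast h) (by positivity)⟩

/-- The factor `(n x - i) / (n - i)` as a continuous function on the unit interval. -/
def gridFactor (n i : ℕ) : C(unitInterval, ℝ) :=
  ⟨fun x => ((n : ℝ) * x - i) / (n - i), by fun_prop⟩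

/-- The inclusion of the unit interval in `ℝ`. -/
def unitIntervalCoe : C(unitInterval, ℝ) := ⟨fun x => x, by fun_prop⟩

theorem tendsto_gridFactor (i : ℕ) :
    Tendsto (fun n => gridFactor n i) atTop (𝓝 unitIntervalCoe) := by
  rw [tendsto_iff_dist_tendsto_zero]
  have h0 : Tendsto (fun n : ℕ => (i : ℝ) / ((n : ℝ) - i)) atTop (𝓝 0) :=
    tendsto_const_nhds.div_atTop
      (tendsto_atTop_add_const_right _ (-(i : ℝ)) tendsto_natCast_atTop_atTop)
  refine squeeze_zero' (Eventually.of_forall fun _ => dist_nonneg) ?_ h0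
  filter_upwards [eventually_gt_atTop i] with n hn
  have hp : (0 : ℝ) < n - i := sub_pos.2 (by exact_mod_cast hn)
  rw [ContinuousMap.dist_le (by positivity)]
  intro x
  have hx := x.2
  have : ((n : ℝ) * x - i) / (n - i) - x = - (i / (n - i) * (1 - x)) := by
    field_simp; ring
  simp only [gridFactor, unitIntervalCoe, ContinuousMap.coe_mk, Real.dist_eq]
  rw [this, abs_neg, abs_of_nonneg (mul_nonneg (by positivity) (by linarith [hx.2]))]
  exact mul_le_of_le_one_right (by positivity) (by linarith [hx.1])

theorem prod_gridFactor_gridPoint {n k : ℕ} (j : ℕ) (h : k ≤ n) (hn : 0 < n) :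
    (∏ i ∈ Finset.range j, gridFactor n i) (gridPoint n k) =
      (k.descFactorial j : ℝ) / n.descFactorial j := by
  rw [ContinuousMap.prod_apply, cast_descFactorial_eq_prod, cast_descFactorial_eq_prod,
    ← Finset.prod_div_distrib]
  refine Finset.prod_congr rfl fun i _ => ?_
  have : (n : ℝ) ≠ 0 := by positivity
  simp only [gridFactor, ContinuousMap.coe_mk, coe_gridPoint h]
  rw [mul_div_cancel₀ _ this]

/-- Hausdorff's moment theorem: a completely monotone sequence is the moment sequence of a
finite measure on the unit interval. -/
theorem exists_finiteMeasure_moments (c : ℕ → ℝ)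
    (hc : ∀ k n, 0 ≤ momentFunctional c (Polynomial.X ^ k * (1 - Polynomial.X) ^ n)) :
    ∃ ν : FiniteMeasure unitInterval, ∀ k : ℕ, ∫ x, (x : ℝ) ^ k ∂(ν : Measure unitInterval) = c k := by
  set w : ℕ → ℕ → ℝ := fun n k =>
    n.choose k * momentFunctional c (Polynomial.X ^ k * (1 - Polynomial.X) ^ (n - k)) with hw
  have hw0 : ∀ n k, 0 ≤ w n k := fun n k => mul_nonneg (by positivity) (hc _ _)
  let ν' : ℕ → Measure unitInterval := fun n =>
    ∑ k ∈ Finset.range (n + 1), ENNReal.ofReal (w n k) • Measure.dirac (gridPoint n k)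
  have hfin : ∀ n, IsFiniteMeasure (ν' n) := fun n => by
    refine ⟨?_⟩
    simp [ν', ENNReal.sum_lt_top]
  have h_integral : ∀ n (g : C(unitInterval, ℝ)), ∫ x, g x ∂(ν' n) =
      ∑ k ∈ Finset.range (n + 1), w n k * g (gridPoint n k) := by
    intro n g
    rw [integral_finsetSum_measure]
    · refine Finset.sum_congr rfl fun k _ => ?_
      rw [integral_smul_measure, integral_dirac, ENNReal.toReal_ofReal (hw0 n k), smul_eq_mul]
    · intro k _
      exact (integrable_dirac (by simp)).smul_measure (by simp)
  have hsum : ∀ n j, j ≤ n →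
      ∑ k ∈ Finset.range (n + 1), w n k * k.descFactorial j = n.descFactorial j * c j := by
    intro n j hj
    have := congrArg (momentFunctional c) (descFactorial_smul_X_pow j n hj)
    rw [map_sum, map_smul, momentFunctional_X_pow, smul_eq_mul] at this
    rw [← this]
    refine Finset.sum_congr rfl fun k _ => ?_
    rw [map_smul, smul_eq_mul]
    simp only [hw]; ring
  have hmom : ∀ j, ∀ n, j ≤ n → 0 < n →
      ∫ x, (∏ i ∈ Finset.range j, gridFactor n i) x ∂(ν' n) = c j := by
    intro j n hj hn
    rw [h_integral]
    have hne : (n.descFactorial j : ℝ) ≠ 0 := by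
      exact_mod_cast (Nat.descFactorial_eq_zero_iff_lt.not.2 (by omega))
    rw [← mul_right_inj' hne, ← hsum n j hj, Finset.mul_sum]
    refine Finset.sum_congr rfl fun k hk => ?_
    rw [prod_gridFactor_gridPoint j (by simpa [Nat.lt_succ_iff] using hk) hn]
    field_simp
  let νs : ℕ → FiniteMeasure unitInterval := fun n => ⟨ν' n, hfin n⟩
  have hmass : ∀ n, (ν' n).real univ = c 0 := by
    intro n
    have h1 := h_integral n 1
    have h2 := hsum n 0 (Nat.zero_le _)
    simp at h1 h2
    rw [h1, h2]
  have hc0 : 0 ≤ c 0 := by rw [← hmass 0]; positivity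
  obtain ⟨ν, -, hν⟩ := (isCompact_setOfPred_finiteMeasure_le_of_compactSpace unitInterval
    (Real.toNNReal (c 0))).exists_mapClusterPt_of_frequently (f := νs) (l := atTop)
    (Eventually.frequently (Eventually.of_forall fun n => by
      change (νs n).mass ≤ _
      rw [← NNReal.coe_le_coe, Real.coe_toNNReal _ hc0, ← hmass n]
      exact le_of_eq rfl))
  refine ⟨ν, fun j => ?_⟩
  obtain ⟨U, hU, hUν⟩ := mapClusterPt_iff_ultrafilter.1 hν
  rw [FiniteMeasure.tendsto_iff_forall_integral_tendsto] at hUν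
  have hlim := hUν (BoundedContinuousFunction.mkOfCompact (unitIntervalCoe ^ j))
  have hg : Tendsto (fun n => ∏ i ∈ Finset.range j, gridFactor n i) atTop
      (𝓝 (unitIntervalCoe ^ j)) := by
    have := tendsto_finsetProd (Finset.range j) fun i _ => tendsto_gridFactor i
    simpa using this
  have hd : Tendsto (fun n => dist (∏ i ∈ Finset.range j, gridFactor n i) (unitIntervalCoe ^ j) * c 0)
      U (𝓝 0) := by
    have := ((tendsto_iff_dist_tendsto_zero.1 hg).mono_left hU).mul_const (c 0)
    simpa using this
  have hdiff : Tendsto (fun n => ∫ x, (unitIntervalCoe ^ j) x ∂(ν' n)) U (𝓝 (c j)) := by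
    rw [tendsto_iff_dist_tendsto_zero]
    refine squeeze_zero' (Eventually.of_forall fun _ => dist_nonneg) ?_ hd
    filter_upwards [hU (eventually_ge_atTop j), hU (eventually_gt_atTop 0)] with n hn hn0
    have hI : ∀ g : C(unitInterval, ℝ), Integrable g (ν' n) := fun g =>
      (BoundedContinuousFunction.mkOfCompact g).integrable (ν' n)
    rw [← hmom j n hn hn0, Real.dist_eq, ← integral_sub (hI _) (hI _), ← hmass n,
      ← Real.norm_eq_abs]
    refine norm_integral_le_of_norm_le_const (Eventually.of_forall fun x => ?_)
    rw [← dist_eq_norm, dist_comm]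
    exact ContinuousMap.dist_apply_le_dist x
  exact tendsto_nhds_unique hlim hdiff

/-- A finite measure on the unit interval is determined by its moments. -/
theorem ext_of_moments {ν ν' : Measure unitInterval} [IsFiniteMeasure ν] [IsFiniteMeasure ν']
    (h : ∀ k : ℕ, ∫ x, (x : ℝ) ^ k ∂ν = ∫ x, (x : ℝ) ^ k ∂ν') : ν = ν' := by
  have hI : ∀ (ρ : Measure unitInterval) [IsFiniteMeasure ρ] (g : C(unitInterval, ℝ)),
      Integrable g ρ := fun ρ _ g =>
    (BoundedContinuousFunction.mkOfCompact g).integrable ρ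
  have hcont : ∀ (ρ : Measure unitInterval) [IsFiniteMeasure ρ],
      Continuous fun g : C(unitInterval, ℝ) => ∫ x, g x ∂ρ := by
    intro ρ _
    refine (LipschitzWith.of_dist_le_mul (K := ⟨ρ.real univ, measureReal_nonneg⟩)
      fun g g' => ?_).continuous
    rw [dist_eq_norm, ← integral_sub (hI ρ g) (hI ρ g'), mul_comm]
    refine norm_integral_le_of_norm_le_const (Eventually.of_forall fun x => ?_)
    rw [← dist_eq_norm]
    exact ContinuousMap.dist_apply_le_dist x
  have hclosed : IsClosed {g : C(unitInterval, ℝ) | ∫ x, g x ∂ν = ∫ x, g x ∂ν'} :=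
    isClosed_eq (hcont ν) (hcont ν')
  have hpoly : ∀ p : Polynomial ℝ, ∫ x : unitInterval, p.eval (x : ℝ) ∂ν =
      ∫ x : unitInterval, p.eval (x : ℝ) ∂ν' := by
    intro p
    induction p using Polynomial.induction_on' with
    | add p q hp hq =>
      have hip : ∀ (ρ : Measure unitInterval) [IsFiniteMeasure ρ] (p : Polynomial ℝ),
          Integrable (fun x : unitInterval => p.eval (x : ℝ)) ρ := fun ρ _ p =>
        hI ρ ⟨fun x => p.eval (x : ℝ), by fun_prop⟩
      simp only [Polynomial.eval_add]
      rw [integral_add (hip ν p) (hip ν q), integral_add (hip ν' p) (hip ν' q), hp, hq]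
    | monomial n a =>
      simp only [Polynomial.eval_monomial, integral_const_mul, h n]
  refine ext_of_forall_integral_eq_of_IsFiniteMeasure fun f => ?_
  have hmem : f.toContinuousMap ∈ (polynomialFunctions unitInterval).topologicalClosure := by
    rw [polynomialFunctions_closure_eq_top']; trivial
  refine hclosed.closure_subset_iff.2 ?_ hmem
  rintro g ⟨p, -, rfl⟩
  simpa using hpoly p

theorem momentFunctional_mul_one_sub_X (c : ℕ → ℝ) (p : Polynomial ℝ) :
    momentFunctional c (p * (1 - Polynomial.X)) =
      momentFunctional (fun k => c k - c (k + 1)) p := by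
  induction p using Polynomial.induction_on' with
  | add p q hp hq => rw [add_mul, map_add, map_add, hp, hq]
  | monomial n a =>
    rw [← Polynomial.C_mul_X_pow_eq_monomial, ← Polynomial.smul_eq_C_mul, smul_mul_assoc,
      map_smul, map_smul, mul_sub, mul_one, ← pow_succ, map_sub]
    simp

/-- Scalar completely monotone functions on `(0,∞)`. -/
structure ScalarCM (f : ℝ → ℝ) : Prop where
  contDiffOn : ContDiffOn ℝ (⊤ : ℕ∞) f (Ioi 0)
  nonneg : ∀ n : ℕ, ∀ t ∈ Ioi (0 : ℝ), 0 ≤ (-1 : ℝ) ^ n * iteratedDeriv n f t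

namespace ScalarCM

variable {f : ℝ → ℝ}

theorem contDiffAt (hf : ScalarCM f) {n : ℕ} {t : ℝ} (ht : 0 < t) : ContDiffAt ℝ n f t :=
  (hf.contDiffOn.contDiffAt (Ioi_mem_nhds ht)).of_le (by exact_mod_cast le_top)

theorem hasDerivAt_iteratedDeriv (hf : ScalarCM f) (n : ℕ) {t : ℝ} (ht : 0 < t) :
    HasDerivAt (iteratedDeriv n f) (iteratedDeriv (n + 1) f t) t := by
  rw [iteratedDeriv_succ]
  have h1 := hf.contDiffOn.differentiableOn_iteratedDerivWithin (m := n)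
    (by exact_mod_cast WithTop.coe_lt_top _) isOpen_Ioi.uniqueDiffOn
  exact ((h1.congr fun t ht => (iteratedDerivWithin_of_isOpen isOpen_Ioi ht).symm).differentiableAt
    (Ioi_mem_nhds ht)).hasDerivAt

theorem antitoneOn (hf : ScalarCM f) (n : ℕ) :
    AntitoneOn (fun t => (-1 : ℝ) ^ n * iteratedDeriv n f t) (Ioi 0) := by
  have hd : ∀ t ∈ Ioi (0 : ℝ), HasDerivAt (fun t => (-1 : ℝ) ^ n * iteratedDeriv n f t)
      ((-1 : ℝ) ^ n * iteratedDeriv (n + 1) f t) t := fun t ht =>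
    (hf.hasDerivAt_iteratedDeriv n ht).const_mul _
  refine antitoneOn_of_deriv_nonpos (convex_Ioi 0)
    (fun t ht => (hd t ht).continuousAt.continuousWithinAt)
    (fun t ht => (hd t (interior_subset ht)).differentiableAt.differentiableWithinAt) ?_
  intro t ht
  rw [interior_Ioi] at ht
  rw [(hd t ht).deriv]
  have := hf.nonneg (n + 1) t ht
  rw [pow_succ] at this
  linarith

theorem sub_shift (hf : ScalarCM f) {h : ℝ} (hh : 0 < h) :
    ScalarCM fun t => f t - f (t + h) := by
  have hmaps : MapsTo (fun t : ℝ => t + h) (Ioi 0) (Ioi 0) := fun t ht => add_pos ht hh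
  have hshift : ContDiffOn ℝ (⊤ : ℕ∞) (fun t => f (t + h)) (Ioi 0) :=
    hf.contDiffOn.comp (by fun_prop) hmaps
  refine ⟨hf.contDiffOn.sub hshift, fun n t ht => ?_⟩
  have h1 : iteratedDeriv n (fun t => f t - f (t + h)) t =
      iteratedDeriv n f t - iteratedDeriv n f (t + h) := by
    rw [← congrFun (iteratedDeriv_comp_add_const n f h) t]
    exact iteratedDeriv_sub (hf.contDiffAt ht)
      ((hshift.contDiffAt (Ioi_mem_nhds ht)).of_le (by exact_mod_cast le_top))
  rw [h1, mul_sub, sub_nonneg]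
  exact hf.antitoneOn n ht (hmaps ht) (by linarith)

theorem momentFunctional_nonneg {a h : ℝ} (ha : 0 < a) (hh : 0 < h) (k n : ℕ) :
    ∀ {f : ℝ → ℝ}, ScalarCM f → 0 ≤ momentFunctional (fun k : ℕ => f (a + k * h))
      (Polynomial.X ^ k * (1 - Polynomial.X) ^ n) := by
  induction n with
  | zero =>
    intro f hf
    have := hf.nonneg 0 (a + k * h) (by simp only [mem_Ioi]; positivity)
    simpa using this
  | succ n ih =>
    intro f hf
    rw [pow_succ, ← mul_assoc, momentFunctional_mul_one_sub_X]
    convert ih (hf.sub_shift hh) using 6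
    push_cast; ring

theorem exists_lattice_moments (hf : ScalarCM f) {a h : ℝ} (ha : 0 < a) (hh : 0 < h) :
    ∃ ν : FiniteMeasure unitInterval, ∀ k : ℕ,
      ∫ x, (x : ℝ) ^ k ∂(ν : Measure unitInterval) = f (a + k * h) :=
  exists_finiteMeasure_moments _ fun k n => momentFunctional_nonneg ha hh k n hf

theorem exists_real_moments (hf : ScalarCM f) {a : ℝ} (ha : 0 < a) :
    ∃ ν : FiniteMeasure unitInterval, ∀ t : ℝ, 0 < t →
      ∫ x, (x : ℝ) ^ t ∂(ν : Measure unitInterval) = f (a + t) := by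
  obtain ⟨ν, hν⟩ := hf.exists_lattice_moments ha one_pos
  refine ⟨ν, ?_⟩
  have hrat : ∀ N k : ℕ, 0 < N →
      ∫ x, (x : ℝ) ^ ((k : ℝ) / N) ∂(ν : Measure unitInterval) = f (a + k / N) := by
    intro N k hN
    have hN' : (0 : ℝ) < N := by exact_mod_cast hN
    obtain ⟨νN, hνN⟩ := hf.exists_lattice_moments ha (inv_pos.2 hN')
    have hmeas : Measurable fun x : unitInterval => x ^ N := (continuous_pow N).measurable
    have heq : (ν : Measure unitInterval) = (νN : Measure unitInterval).map fun x => x ^ N := by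
      refine ext_of_moments fun k => ?_
      rw [hν, integral_map hmeas.aemeasurable
        (Continuous.aestronglyMeasurable (by fun_prop))]
      have := hνN (N * k)
      simp only [Set.Icc.coe_pow, ← pow_mul]
      rw [this]
      congr 1
      push_cast
      field_simp
    rw [heq, integral_map hmeas.aemeasurable
      (Continuous.aestronglyMeasurable
        (by exact Continuous.rpow_const (by fun_prop) fun _ => Or.inr (by positivity)))]
    rw [div_eq_mul_inv, ← hνN k]
    refine integral_congr_ae (Eventually.of_forall fun x => ?_)
    have hx : (0 : ℝ) ≤ x := x.2.1
    simp only [Set.Icc.coe_pow]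
    rw [← Real.rpow_natCast, ← Real.rpow_mul hx, ← Real.rpow_natCast]
    congr 1
    field_simp
  have hcl : EqOn (fun t : ℝ => ∫ x, (x : ℝ) ^ t ∂(ν : Measure unitInterval))
      (fun t => f (a + t)) (Ioi 0) := by
    refine EqOn.of_subset_closure (s := Ioi 0 ∩ range ((↑) : ℚ → ℝ)) ?_ ?_ ?_ inter_subset_left
      (Rat.isDenseEmbedding_coe_real.dense.open_subset_closure_inter isOpen_Ioi)
    · rintro _ ⟨hq, q, rfl⟩
      have hq' : 0 < q := by simpa using hq
      have h1 : ((q : ℚ) : ℝ) = (q.num.toNat : ℝ) / q.den := by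
        conv_lhs => rw [← Rat.num_div_den q]
        push_cast
        congr 1
        have : ((q.num.toNat : ℤ) : ℝ) = q.num := by
          rw [Int.toNat_of_nonneg (Rat.num_nonneg.2 hq'.le)]
        exact_mod_cast this.symm
      simp only [h1]
      exact hrat _ _ q.den_pos
    · intro t ht
      refine ContinuousAt.continuousWithinAt ?_
      refine continuousAt_of_dominated (bound := fun _ => 1) ?_ ?_ (integrable_const _) ?_
      · filter_upwards [Ioi_mem_nhds ht] with s hs
        exact Continuous.aestronglyMeasurable
          (Continuous.rpow_const (by fun_prop) fun _ => Or.inr (le_of_lt hs))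
      · filter_upwards [Ioi_mem_nhds ht] with s hs
        refine Eventually.of_forall fun x => ?_
        rw [Real.norm_of_nonneg (Real.rpow_nonneg x.2.1 _)]
        exact Real.rpow_le_one x.2.1 x.2.2 (le_of_lt hs)
      · exact Eventually.of_forall fun x => Real.continuousAt_const_rpow' (ne_of_gt ht)
    · exact hf.contDiffOn.continuousOn.comp (by fun_prop) fun t ht => add_pos ha ht
  exact fun t ht => hcl ht

theorem exists_measure_shift (hf : ScalarCM f) {a : ℝ} (ha : 0 < a) :
    ∃ μ : Measure ℝ, SigmaFinite μ ∧ μ (Iio 0) = 0 ∧ ∀ t : ℝ, a < t →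
      ∫⁻ r, ENNReal.ofReal (Real.exp (-r * t)) ∂μ = ENNReal.ofReal (f t) := by
  obtain ⟨ν, hν⟩ := hf.exists_real_moments ha
  set ρ : Measure ℝ := ((ν : Measure unitInterval).restrict {x | 0 < x}).map
    (fun x : unitInterval => -Real.log x) with hρ
  have hlog : Measurable fun x : unitInterval => -Real.log x :=
    (Real.measurable_log.comp measurable_subtype_coe).neg
  have hdens : Measurable fun r : ℝ => ENNReal.ofReal (Real.exp (r * a)) := by fun_prop
  refine ⟨ρ.withDensity fun r => ENNReal.ofReal (Real.exp (r * a)), ?_, ?_, ?_⟩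
  · exact SigmaFinite.withDensity_of_ne_top (Eventually.of_forall fun _ => ENNReal.ofReal_ne_top)
  · refine withDensity_absolutelyContinuous _ _ ?_
    have hempty : (fun x : unitInterval => -Real.log x) ⁻¹' Iio 0 = ∅ := by
      ext x
      simpa using Real.log_nonpos x.2.1 x.2.2
    rw [hρ, Measure.map_apply hlog measurableSet_Iio, hempty, measure_empty]
  · intro t ht
    rw [lintegral_withDensity_eq_lintegral_mul _ hdens (by fun_prop), hρ,
      lintegral_map (by fun_prop) hlog]
    have h1 : ∀ x ∈ {x : unitInterval | 0 < x},
        ((fun r : ℝ => ENNReal.ofReal (Real.exp (r * a))) *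
          fun r : ℝ => ENNReal.ofReal (Real.exp (-r * t))) (-Real.log x) =
        ENNReal.ofReal ((x : ℝ) ^ (t - a)) := by
      intro x hx
      have hx' : (0 : ℝ) < x := hx
      simp only [Pi.mul_apply]
      rw [← ENNReal.ofReal_mul (Real.exp_nonneg _), ← Real.exp_add, Real.rpow_def_of_pos hx']
      congr 2; ring
    have hms : MeasurableSet {x : unitInterval | 0 < x} := measurableSet_Ioi
    rw [setLIntegral_congr_fun hms h1, setLIntegral_eq_of_support_subset]
    · rw [← ofReal_integral_eq_lintegral_ofReal, hν (t - a) (sub_pos.2 ht)]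
      · congr 2; ring
      · refine Integrable.mono' (integrable_const 1) (Continuous.aestronglyMeasurable
          (Continuous.rpow_const (by fun_prop) fun _ => Or.inr (sub_pos.2 ht).le))
          (Eventually.of_forall fun x => ?_)
        rw [Real.norm_of_nonneg (Real.rpow_nonneg x.2.1 _)]
        exact Real.rpow_le_one x.2.1 x.2.2 (sub_pos.2 ht).le
      · exact Eventually.of_forall fun x => Real.rpow_nonneg x.2.1 _
    · intro x hx
      by_contra hx0
      have h0 : (x : ℝ) = 0 := by simpa using hx0
      simp [h0, Real.zero_rpow (sub_pos.2 ht).ne'] at hx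

end ScalarCM

/-- A measure on `[0,∞)` is determined by its Laplace transform near infinity. -/
theorem ext_of_laplace {μ μ' : Measure ℝ} (h0 : μ (Iio 0) = 0) (h0' : μ' (Iio 0) = 0) {T : ℝ}
    (hfin : ∀ t, T < t → ∫⁻ r, ENNReal.ofReal (Real.exp (-r * t)) ∂μ ≠ ⊤)
    (heq : ∀ t, T < t → ∫⁻ r, ENNReal.ofReal (Real.exp (-r * t)) ∂μ =
      ∫⁻ r, ENNReal.ofReal (Real.exp (-r * t)) ∂μ') : μ = μ' := by
  set d : ℝ → ENNReal := fun r => ENNReal.ofReal (Real.exp (-r * (T + 1))) with hd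
  have hdm : Measurable d := by fun_prop
  let φ : ℝ → unitInterval := fun r => projIcc 0 1 zero_le_one (Real.exp (-r))
  have hφ : Measurable φ := (continuous_projIcc.comp (by fun_prop)).measurable
  have hlog : Measurable fun x : unitInterval => -Real.log x :=
    (Real.measurable_log.comp measurable_subtype_coe).neg
  have hφc : ∀ r, 0 ≤ r → (φ r : ℝ) = Real.exp (-r) := fun r hr => by
    simp only [φ]
    rw [projIcc_of_mem zero_le_one (x := Real.exp (-r)) ⟨Real.exp_nonneg _, by simpa using hr⟩]
  have hae : ∀ μ : Measure ℝ, μ (Iio 0) = 0 → ∀ᵐ r ∂(μ.withDensity d), 0 ≤ r := fun μ h => by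
    have := withDensity_absolutelyContinuous μ d h
    rw [ae_iff]; simpa [Iio] using this
  have hmom : ∀ μ : Measure ℝ, μ (Iio 0) = 0 → ∀ k : ℕ,
      ∫⁻ x, ENNReal.ofReal ((x : ℝ) ^ k) ∂((μ.withDensity d).map φ) =
        ∫⁻ r, ENNReal.ofReal (Real.exp (-r * (T + 1 + k))) ∂μ := by
    intro μ h k
    rw [lintegral_map (by fun_prop) hφ]
    have : ∀ᵐ r ∂(μ.withDensity d), ENNReal.ofReal ((φ r : ℝ) ^ k) =
        ENNReal.ofReal (Real.exp (-r * k)) := by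
      filter_upwards [hae μ h] with r hr
      rw [hφc r hr, ← Real.exp_nat_mul]
      congr 2; ring
    rw [lintegral_congr_ae this, lintegral_withDensity_eq_lintegral_mul _ hdm (by fun_prop)]
    refine lintegral_congr fun r => ?_
    simp only [Pi.mul_apply, hd]
    rw [← ENNReal.ofReal_mul (Real.exp_nonneg _), ← Real.exp_add]
    congr 2; ring
  have hF : ∀ μ : Measure ℝ, μ (Iio 0) = 0 →
      ∫⁻ r, ENNReal.ofReal (Real.exp (-r * (T + 1))) ∂μ ≠ ⊤ →
      IsFiniteMeasure ((μ.withDensity d).map φ) := by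
    intro μ h hf
    have := hmom μ h 0
    simp only [pow_zero, ENNReal.ofReal_one, lintegral_one, Nat.cast_zero, add_zero] at this
    exact ⟨by rw [this]; exact hf.lt_top⟩
  have hf1 := hF μ h0 (hfin _ (by linarith))
  have hf2 := hF μ' h0' (by rw [← heq _ (by linarith)]; exact hfin _ (by linarith))
  have hmap : (μ.withDensity d).map φ = (μ'.withDensity d).map φ := by
    refine ext_of_moments fun k => ?_
    rw [integral_eq_lintegral_of_nonneg_ae, integral_eq_lintegral_of_nonneg_ae,
      hmom μ h0, hmom μ' h0', heq]
    · have : (0 : ℝ) ≤ k := by positivity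
      linarith
    · exact Eventually.of_forall fun x => pow_nonneg x.2.1 _
    · exact Continuous.aestronglyMeasurable (by fun_prop)
    · exact Eventually.of_forall fun x => pow_nonneg x.2.1 _
    · exact Continuous.aestronglyMeasurable (by fun_prop)
  have hback : ∀ μ : Measure ℝ, μ (Iio 0) = 0 →
      ((μ.withDensity d).map φ).map (fun x : unitInterval => -Real.log x) = μ.withDensity d := by
    intro μ h
    rw [Measure.map_map hlog hφ]
    conv_rhs => rw [← Measure.map_id (μ := μ.withDensity d)]
    refine Measure.map_congr ?_
    filter_upwards [hae μ h] with r hr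
    simp [hφc r hr]
  have hwd : μ.withDensity d = μ'.withDensity d := by
    rw [← hback μ h0, ← hback μ' h0', hmap]
  have hd0 : ∀ r, d r ≠ 0 := fun r => by simp [hd, Real.exp_pos]
  have hdt : ∀ r, d r ≠ ⊤ := fun r => ENNReal.ofReal_ne_top
  rw [← withDensity_inv_same (μ := μ) hdm (Eventually.of_forall hd0) (Eventually.of_forall hdt),
    hwd, withDensity_inv_same hdm (Eventually.of_forall hd0) (Eventually.of_forall hdt)]

/-- Bernstein's theorem: a completely monotone function on `(0,∞)` is the Laplace transform of a
measure on `[0,∞)`. -/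
theorem ScalarCM.exists_measure {f : ℝ → ℝ} (hf : ScalarCM f) :
    ∃ μ : Measure ℝ, SigmaFinite μ ∧ μ (Iio 0) = 0 ∧ ∀ t : ℝ, 0 < t →
      ∫⁻ r, ENNReal.ofReal (Real.exp (-r * t)) ∂μ = ENNReal.ofReal (f t) := by
  obtain ⟨μ, hσ, h0, hμ⟩ := hf.exists_measure_shift one_pos
  refine ⟨μ, hσ, h0, fun t ht => ?_⟩
  obtain ⟨μ', -, h0', hμ'⟩ := hf.exists_measure_shift (half_pos ht)
  have : μ = μ' := by
    refine ext_of_laplace h0 h0' (T := max 1 (t / 2)) (fun s hs => ?_) fun s hs => ?_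
    · rw [hμ s (lt_of_le_of_lt (le_max_left _ _) hs)]; exact ENNReal.ofReal_ne_top
    · rw [hμ s (lt_of_le_of_lt (le_max_left _ _) hs), hμ' s (lt_of_le_of_lt (le_max_right _ _) hs)]
  rw [this, hμ' t (half_lt_self ht)]

/-- A measure dominated by a σ-finite measure has a density with values in `[0,1]`. -/
theorem exists_density_of_le {μ μ₀ : Measure ℝ} [SigmaFinite μ] [SigmaFinite μ₀] (h : μ ≤ μ₀) :
    ∃ g : ℝ → ℝ, Measurable g ∧ (∀ r, 0 ≤ g r ∧ g r ≤ 1) ∧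
      μ = μ₀.withDensity fun r => ENNReal.ofReal (g r) := by
  refine ⟨fun r => min 1 (μ.rnDeriv μ₀ r).toReal,
    measurable_const.min (Measure.measurable_rnDeriv _ _).ennreal_toReal,
    fun r => ⟨le_min zero_le_one ENNReal.toReal_nonneg, min_le_left _ _⟩, ?_⟩
  conv_lhs => rw [← Measure.withDensity_rnDeriv_eq μ μ₀ (Measure.absolutelyContinuous_of_le h)]
  refine withDensity_congr_ae ?_
  filter_upwards [Measure.rnDeriv_le_one_of_le h] with r hr
  have hr' : μ.rnDeriv μ₀ r ≠ ⊤ := ne_top_of_le_ne_top ENNReal.one_ne_top hr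
  rw [min_eq_right, ENNReal.ofReal_toReal hr']
  exact ENNReal.toReal_le_of_le_ofReal zero_le_one (by simpa using hr)

theorem integrable_and_integral_of_density {μ₀ : Measure ℝ} {g w : ℝ → ℝ} (hg : Measurable g)
    (hw : Measurable w) (hg0 : ∀ r, 0 ≤ g r) (hw0 : ∀ r, 0 ≤ w r) {c : ℝ} (hc : 0 ≤ c)
    (h : ∫⁻ r, ENNReal.ofReal (w r) ∂(μ₀.withDensity fun r => ENNReal.ofReal (g r)) =
      ENNReal.ofReal c) :
    Integrable (fun r => w r * g r) μ₀ ∧ ∫ r, w r * g r ∂μ₀ = c := by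
  rw [lintegral_withDensity_eq_lintegral_mul _ hg.ennreal_ofReal hw.ennreal_ofReal] at h
  have h' : ∫⁻ r, ENNReal.ofReal (w r * g r) ∂μ₀ = ENNReal.ofReal c := by
    rw [← h]
    refine lintegral_congr fun r => ?_
    rw [Pi.mul_apply, mul_comm, ENNReal.ofReal_mul (hg0 r)]
  have hnn : 0 ≤ᵐ[μ₀] fun r => w r * g r :=
    Eventually.of_forall fun r => mul_nonneg (hw0 r) (hg0 r)
  refine ⟨⟨(hw.mul hg).aestronglyMeasurable, ?_⟩, ?_⟩
  · rw [hasFiniteIntegral_iff_ofReal hnn, h']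
    exact ENNReal.ofReal_lt_top
  · rw [integral_eq_lintegral_of_nonneg_ae hnn (hw.mul hg).aestronglyMeasurable, h',
      ENNReal.toReal_ofReal hc]

/-- If the Laplace transform of `h dμ₀` is that of a positive measure, then `h ≥ 0` a.e. -/
theorem ae_nonneg_of_laplace {μ₀ μ : Measure ℝ} (h0 : μ₀ (Iio 0) = 0) (h0' : μ (Iio 0) = 0)
    {h : ℝ → ℝ} (hm : Measurable h)
    (hi : ∀ t, 0 < t → Integrable (fun r => Real.exp (-r * t) * h r) μ₀)
    (hnn : ∀ t, 0 < t → 0 ≤ ∫ r, Real.exp (-r * t) * h r ∂μ₀)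
    (heq : ∀ t, 0 < t → ∫⁻ r, ENNReal.ofReal (Real.exp (-r * t)) ∂μ =
      ENNReal.ofReal (∫ r, Real.exp (-r * t) * h r ∂μ₀)) :
    ∀ᵐ r ∂μ₀, 0 ≤ h r := by
  have hdens : ∀ g : ℝ → ℝ, Measurable g → ∀ t : ℝ,
      ∫⁻ r, ENNReal.ofReal (Real.exp (-r * t)) ∂(μ₀.withDensity fun r => ENNReal.ofReal (g r)) =
        ∫⁻ r, ENNReal.ofReal (Real.exp (-r * t) * g r) ∂μ₀ := by
    intro g hg t
    rw [lintegral_withDensity_eq_lintegral_mul _ hg.ennreal_ofReal (by fun_prop)]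
    refine lintegral_congr fun r => ?_
    rw [Pi.mul_apply, mul_comm, ENNReal.ofReal_mul (Real.exp_nonneg _)]
  have hfin : ∀ g : ℝ → ℝ, ∀ t, Integrable (fun r => Real.exp (-r * t) * g r) μ₀ →
      ∫⁻ r, ENNReal.ofReal (Real.exp (-r * t) * g r) ∂μ₀ ≠ ⊤ := fun g t hgt =>
    (lt_of_le_of_lt (lintegral_mono fun r => Real.ofReal_le_enorm _) hgt.2).ne
  have hneg : ∀ t, 0 < t → Integrable (fun r => Real.exp (-r * t) * -h r) μ₀ := fun t ht => by
    simpa using (hi t ht).neg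
  have key : (μ₀.withDensity fun r => ENNReal.ofReal (h r)) =
      μ + μ₀.withDensity fun r => ENNReal.ofReal (-h r) := by
    refine ext_of_laplace (T := 0) (withDensity_absolutelyContinuous _ _ h0) ?_
      (fun t ht => by rw [hdens h hm]; exact hfin h t (hi t ht)) fun t ht => ?_
    · rw [Measure.add_apply, h0', withDensity_absolutelyContinuous _ _ h0, add_zero]
    · rw [lintegral_add_measure, hdens h hm, hdens (fun r => -h r) hm.neg, heq t ht]
      have h1 := hfin h t (hi t ht)
      have h2 := hfin (fun r => -h r) t (hneg t ht)
      have h3 := integral_eq_lintegral_pos_part_sub_lintegral_neg_part (hi t ht)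
      simp only [← mul_neg] at h3
      rw [← ENNReal.toReal_eq_toReal_iff' h1 (ENNReal.add_ne_top.2 ⟨ENNReal.ofReal_ne_top, h2⟩),
        ENNReal.toReal_add ENNReal.ofReal_ne_top h2, ENNReal.toReal_ofReal (hnn t ht), h3]
      ring
  have hS : MeasurableSet {r | h r < 0} := measurableSet_lt hm measurable_const
  have hle : (μ₀.withDensity fun r => ENNReal.ofReal (-h r)) {r | h r < 0} ≤
      (μ₀.withDensity fun r => ENNReal.ofReal (h r)) {r | h r < 0} := by
    rw [key]; exact Measure.le_add_left le_rfl _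
  have hz : (μ₀.withDensity fun r => ENNReal.ofReal (h r)) {r | h r < 0} = 0 := by
    rw [withDensity_apply _ hS, setLIntegral_congr_fun hS (g := fun _ => 0), lintegral_zero]
    exact fun r hr => ENNReal.ofReal_of_nonpos (le_of_lt hr)
  have hmn : Measurable fun r => ENNReal.ofReal (-h r) := hm.neg.ennreal_ofReal
  rw [hz, nonpos_iff_eq_zero, withDensity_apply_eq_zero hmn] at hle
  rw [ae_iff]
  refine measure_mono_null (fun r hr => ?_) hle
  have : h r < 0 := not_le.1 hr
  exact ⟨by simpa using this, this⟩

/-- Local integrability of a Laplace transform gives integrability of `(1 + r)⁻¹`. -/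
theorem lintegral_inv_one_add_lt_top {μ : Measure ℝ} [SFinite μ] (h0 : μ (Iio 0) = 0) {f : ℝ → ℝ}
    (hf : ∀ t, 0 < t → ∫⁻ r, ENNReal.ofReal (Real.exp (-r * t)) ∂μ = ENNReal.ofReal (f t))
    (h_integral : IntegrableOn f (Ioc 0 1)) :
    ∫⁻ r, ENNReal.ofReal ((1 + r)⁻¹) ∂μ < ⊤ := by
  have h1 : ∫⁻ t in Ioc (0 : ℝ) 1, ∫⁻ r, ENNReal.ofReal (Real.exp (-r * t)) ∂μ < ⊤ := by
    rw [setLIntegral_congr_fun measurableSet_Ioc (fun t ht => hf t ht.1)]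
    exact lt_of_le_of_lt (lintegral_mono fun r => Real.ofReal_le_enorm _) h_integral.2
  rw [lintegral_lintegral_swap (by fun_prop)] at h1
  have hpos : 0 < ENNReal.ofReal (Real.exp (-1)) := by simp [Real.exp_pos]
  have h2 : ENNReal.ofReal (Real.exp (-1)) * ∫⁻ r, ENNReal.ofReal ((1 + r)⁻¹) ∂μ < ⊤ := by
    rw [← lintegral_const_mul _ (by fun_prop)]
    refine lt_of_le_of_lt (lintegral_mono_ae ?_) h1
    have hae : ∀ᵐ r ∂μ, 0 ≤ r := by rw [ae_iff]; simpa [Iio] using h0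
    filter_upwards [hae] with r hr
    have hr1 : 0 < 1 + r := by linarith
    have hsub : Ioc 0 ((1 + r)⁻¹) ⊆ Ioc (0 : ℝ) 1 :=
      Ioc_subset_Ioc_right (inv_le_one_of_one_le₀ (by linarith))
    calc ENNReal.ofReal (Real.exp (-1)) * ENNReal.ofReal ((1 + r)⁻¹)
        = ∫⁻ _ in Ioc 0 ((1 + r)⁻¹), ENNReal.ofReal (Real.exp (-1)) := by simp
      _ ≤ ∫⁻ t in Ioc 0 ((1 + r)⁻¹), ENNReal.ofReal (Real.exp (-r * t)) := by
          refine setLIntegral_mono (by fun_prop) fun t ht => ?_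
          refine ENNReal.ofReal_le_ofReal (Real.exp_le_exp.2 ?_)
          have h3 : r * t ≤ (1 + r) * (1 + r)⁻¹ :=
            mul_le_mul (by linarith) ht.2 ht.1.le hr1.le
          rw [mul_inv_cancel₀ hr1.ne'] at h3
          linarith
      _ ≤ ∫⁻ t in Ioc 0 1, ENNReal.ofReal (Real.exp (-r * t)) := lintegral_mono_set hsub
  exact (ENNReal.mul_lt_top_iff.1 h2).elim (fun h => h.2) fun h =>
    h.elim (fun h => absurd h hpos.ne') fun h => by simp [h]

/-- The iterated Laplace transform is a Stieltjes transform. -/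
theorem laplace_laplace {μ : Measure ℝ} [SFinite μ] (h0 : μ (Iio 0) = 0)
    (hμ : ∫⁻ r, ENNReal.ofReal ((1 + r)⁻¹) ∂μ < ⊤) {g : ℝ → ℝ} (hg : Measurable g) {M : ℝ}
    (hM : ∀ r, |g r| ≤ M) {p : ℝ} (hp : 0 < p) :
    ∫ t in Ioi (0 : ℝ), Real.exp (-p * t) * ∫ r, Real.exp (-r * t) * g r ∂μ =
      ∫ r, (p + r)⁻¹ * g r ∂μ := by
  have hae : ∀ᵐ r ∂μ, 0 ≤ r := by rw [ae_iff]; simpa [Iio] using h0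
  have hM0 : 0 ≤ M := (abs_nonneg _).trans (hM 0)
  have hexp : ∀ r : ℝ, 0 ≤ r → IntegrableOn (fun t => Real.exp (-(p + r) * t)) (Ioi 0) :=
    fun r hr => integrableOn_exp_mul_Ioi (by linarith) 0
  have hexpi : ∀ r : ℝ, 0 ≤ r → ∫ t in Ioi 0, Real.exp (-(p + r) * t) = (p + r)⁻¹ := by
    intro r hr
    rw [integral_exp_mul_Ioi (by linarith)]
    rw [mul_zero, Real.exp_zero, neg_div_neg_eq, one_div]
  have hcongr : ∀ r t : ℝ, Real.exp (-p * t) * (Real.exp (-r * t) * g r) =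
      Real.exp (-(p + r) * t) * g r := by
    intro r t
    rw [← mul_assoc, ← Real.exp_add]
    congr 2; ring
  simp_rw [← integral_const_mul, hcongr]
  have hw : Integrable (fun r => (1 + r)⁻¹) μ := by
    have hnn : 0 ≤ᵐ[μ] fun r => (1 + r)⁻¹ := by
      filter_upwards [hae] with r hr
      exact inv_nonneg.2 (by linarith)
    exact ⟨by fun_prop, (hasFiniteIntegral_iff_ofReal hnn).2 hμ⟩
  have h_integral : Integrable (Function.uncurry fun t r : ℝ => Real.exp (-(p + r) * t) * g r)
      ((volume.restrict (Ioi 0)).prod μ) := by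
    rw [integrable_prod_iff' (Measurable.aestronglyMeasurable (by unfold Function.uncurry; fun_prop))]
    constructor
    · filter_upwards [hae] with r hr
      exact (hexp r hr).mul_const (g r)
    · refine (hw.const_mul (max 1 p⁻¹ * M)).mono' ?_ ?_
      · exact (Measurable.stronglyMeasurable
          (by unfold Function.uncurry; fun_prop)).norm.integral_prod_left'.aestronglyMeasurable
      · filter_upwards [hae] with r hr
        have : ∫ t in Ioi (0 : ℝ), ‖Function.uncurry
            (fun t r : ℝ => Real.exp (-(p + r) * t) * g r) (t, r)‖ = (p + r)⁻¹ * |g r| := by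
          simp only [Function.uncurry, norm_mul, Real.norm_eq_abs, Real.abs_exp]
          rw [integral_mul_const, hexpi r hr]
        rw [this, Real.norm_of_nonneg (by positivity)]
        have h1 : (p + r)⁻¹ ≤ max 1 p⁻¹ * (1 + r)⁻¹ := by
          rw [← div_eq_mul_inv, le_div_iff₀ (by linarith), inv_mul_le_iff₀ (by linarith)]
          have h2 : p * p⁻¹ = 1 := mul_inv_cancel₀ hp.ne'
          have h3 := le_max_left 1 p⁻¹
          have h4 := le_max_right 1 p⁻¹
          nlinarith [mul_le_mul_of_nonneg_left h4 hp.le, mul_le_mul_of_nonneg_left h3 hr]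
        calc (p + r)⁻¹ * |g r| ≤ (max 1 p⁻¹ * (1 + r)⁻¹) * M :=
              mul_le_mul h1 (hM r) (abs_nonneg _) (by positivity)
          _ = max 1 p⁻¹ * M * (1 + r)⁻¹ := by ring
  rw [integral_integral_swap h_integral]
  refine integral_congr_ae ?_
  filter_upwards [hae] with r hr
  rw [integral_mul_const, hexpi r hr]

theorem MatCM.scalarCM {m : ℕ} {A : ℝ → Matrix (Fin m) (Fin m) ℝ} (hA : MatCM m A)
    (v : Fin m → ℝ) : ScalarCM fun t => v ⬝ᵥ (A t).mulVec v := by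
  refine ⟨?_, hA.2 v⟩
  simp only [dotProduct, mulVec]
  exact ContDiffOn.sum fun i _ => contDiffOn_const.mul
    (ContDiffOn.sum fun j _ => (hA.1 i j).mul contDiffOn_const)

/-- A symmetric matrix whose quadratic form is nonnegative on rational vectors is positive
semidefinite. -/
theorem posSemidef_of_rat {m : ℕ} {B : Matrix (Fin m) (Fin m) ℝ} (hB : B.IsHermitian)
    (h : ∀ v : Fin m → ℚ, 0 ≤ (fun i => (v i : ℝ)) ⬝ᵥ B.mulVec fun i => (v i : ℝ)) :
    B.PosSemidef := by
  refine .of_dotProduct_mulVec_nonneg hB fun x => ?_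
  rw [star_trivial]
  have hd : DenseRange fun (v : Fin m → ℚ) (i : Fin m) => (v i : ℝ) :=
    DenseRange.piMap fun _ => Rat.denseRange_cast
  have hc : IsClosed {x : Fin m → ℝ | 0 ≤ x ⬝ᵥ B.mulVec x} :=
    isClosed_le continuous_const (by fun_prop)
  exact hd.induction_on x hc h

theorem polarization_s17 {m : ℕ} {B : Matrix (Fin m) (Fin m) ℝ} (hB : B.IsHermitian) (i j : Fin m) :
    ((Pi.single i 1 + Pi.single j 1) ⬝ᵥ B.mulVec (Pi.single i 1 + Pi.single j 1) -
      Pi.single i 1 ⬝ᵥ B.mulVec (Pi.single i 1) -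
      Pi.single j 1 ⬝ᵥ B.mulVec (Pi.single j 1)) / 2 = B i j := by
  have : B j i = B i j := by simpa using hB.apply i j
  simp only [mulVec_add, dotProduct_add, add_dotProduct, mulVec_single_one, single_one_dotProduct,
    Matrix.col_apply]
  rw [this]; ring

/-- Every `S₊`-valued LICM function `A : (0,∞) → S₊` admits an integral
representation: there are a Borel measure `μ` on `[0,∞)` with `∫ (1+r)⁻¹ μ(dr) < ∞` and a
measurable `S₊`-valued function `G` on `[0,∞)`, bounded except possibly on a `μ`-null set,
such that `A(t) = ∫_{[0,∞)} e^{−rt} G(r) μ(dr)` for all `t > 0`; consequently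
`Ã(p) = ∫_{[0,∞)} (p+r)⁻¹ G(r) μ(dr)` for all `p > 0`. -/
theorem licm_integral_representation (m : ℕ) (A : ℝ → Matrix (Fin m) (Fin m) ℝ)
    (hA : MatLICM m A) (hpsd : ∀ t ∈ Set.Ioi (0:ℝ), (A t).PosSemidef) :
    ∃ (μ : MeasureTheory.Measure ℝ) (G : ℝ → Matrix (Fin m) (Fin m) ℝ),
      μ (Set.Iio 0) = 0 ∧
      (∫⁻ r in Set.Ici (0:ℝ), ENNReal.ofReal ((1 + r)⁻¹) ∂μ) < ⊤ ∧
      (∀ i j, Measurable fun r => G r i j) ∧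
      (∀ r, (G r).PosSemidef) ∧
      (∃ M : ℝ, ∀ᵐ r ∂μ, ∀ i j, |G r i j| ≤ M) ∧
      (∀ t ∈ Set.Ioi (0:ℝ),
        A t = Matrix.of fun i j => ∫ r in Set.Ici (0:ℝ), Real.exp (-r * t) * G r i j ∂μ) ∧
      (∀ p ∈ Set.Ioi (0:ℝ),
        matLaplace m A p
          = Matrix.of fun i j => ∫ r in Set.Ici (0:ℝ), (p + r)⁻¹ * G r i j ∂μ) := by
  have hq0 : ∀ v : Fin m → ℝ, ∀ t, 0 < t → 0 ≤ v ⬝ᵥ (A t).mulVec v := fun v t ht => by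
    simpa using (hpsd t ht).dotProduct_mulVec_nonneg v
  choose μs hσ hμs0 hμs using fun v => (hA.1.scalarCM v).exists_measure
  have hq_int : ∀ v : Fin m → ℝ, IntegrableOn (fun t => v ⬝ᵥ (A t).mulVec v) (Ioc 0 1) := by
    intro v
    simp only [dotProduct, mulVec]
    exact integrable_finsetSum _ fun i _ => (integrable_finsetSum _ fun j _ =>
      (hA.2 i j).mul_const (v j)).const_mul (v i)
  let e : Fin m → Fin m → ℝ := fun i => Pi.single i 1
  set μ : Measure ℝ := (Measure.sum fun i => μs (e i)) +
    Measure.sum fun p : Fin m × Fin m => μs (e p.1 + e p.2) with hμ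
  have hμ0 : μ (Iio 0) = 0 := by simp [hμ, hμs0]
  have hle1 : ∀ i, μs (e i) ≤ μ := fun i =>
    (Measure.le_sum (fun i => μs (e i)) i).trans (Measure.le_add_right le_rfl)
  have hle2 : ∀ i j, μs (e i + e j) ≤ μ := fun i j =>
    (Measure.le_sum (fun p : Fin m × Fin m => μs (e p.1 + e p.2)) (i, j)).trans
      (Measure.le_add_left le_rfl)
  have hweight : ∫⁻ r, ENNReal.ofReal ((1 + r)⁻¹) ∂μ < ⊤ := by
    have h1 : ∀ v, ∫⁻ r, ENNReal.ofReal ((1 + r)⁻¹) ∂(μs v) < ⊤ := fun v =>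
      lintegral_inv_one_add_lt_top (hμs0 v) (hμs v) (hq_int v)
    rw [hμ, lintegral_add_measure, lintegral_sum_measure, lintegral_sum_measure, tsum_fintype,
      tsum_fintype]
    exact ENNReal.add_lt_top.2 ⟨ENNReal.sum_lt_top.2 fun i _ => h1 _,
      ENNReal.sum_lt_top.2 fun i _ => h1 _⟩
  choose g1 hg1m hg1b hg1 using fun i => exists_density_of_le (hle1 i)
  choose g2 hg2m hg2b hg2 using fun i j => exists_density_of_le (hle2 i j)
  have hI1 : ∀ i t, 0 < t → Integrable (fun r => Real.exp (-r * t) * g1 i r) μ ∧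
      ∫ r, Real.exp (-r * t) * g1 i r ∂μ = e i ⬝ᵥ (A t).mulVec (e i) := fun i t ht =>
    integrable_and_integral_of_density (hg1m i) (by fun_prop) (fun r => (hg1b i r).1)
      (fun r => Real.exp_nonneg _) (hq0 _ t ht) (by rw [← hg1 i]; exact hμs _ t ht)
  have hI2 : ∀ i j t, 0 < t → Integrable (fun r => Real.exp (-r * t) * g2 i j r) μ ∧
      ∫ r, Real.exp (-r * t) * g2 i j r ∂μ = (e i + e j) ⬝ᵥ (A t).mulVec (e i + e j) :=
    fun i j t ht =>
    integrable_and_integral_of_density (hg2m i j) (by fun_prop) (fun r => (hg2b i j r).1)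
      (fun r => Real.exp_nonneg _) (hq0 _ t ht) (by rw [← hg2 i j]; exact hμs _ t ht)
  have hsymm : ∀ i j, g2 i j =ᵐ[μ] g2 j i := by
    intro i j
    have h1 : (μ.withDensity fun r => ENNReal.ofReal (g2 i j r)) =
        μ.withDensity fun r => ENNReal.ofReal (g2 j i r) := by
      rw [← hg2, ← hg2, add_comm]
    have h2 := (withDensity_eq_iff_of_sigmaFinite (hg2m i j).ennreal_ofReal.aemeasurable
      (hg2m j i).ennreal_ofReal.aemeasurable).1 h1
    filter_upwards [h2] with r hr
    exact (ENNReal.ofReal_eq_ofReal_iff (hg2b i j r).1 (hg2b j i r).1).1 hr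
  let G₀ : ℝ → Matrix (Fin m) (Fin m) ℝ := fun r =>
    Matrix.of fun i j => (g2 i j r - g1 i r - g1 j r) / 2
  have hG₀m : ∀ i j, Measurable fun r => G₀ r i j := fun i j =>
    (((hg2m i j).sub (hg1m i)).sub (hg1m j)).div_const 2
  have hG₀b : ∀ r i j, |G₀ r i j| ≤ 1 := by
    intro r i j
    have h1 := hg1b i r
    have h2 := hg1b j r
    have h3 := hg2b i j r
    simp only [G₀, Matrix.of_apply, abs_le]
    constructor <;> linarith
  have hG₀I : ∀ i j t, 0 < t → Integrable (fun r => Real.exp (-r * t) * G₀ r i j) μ ∧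
      ∫ r, Real.exp (-r * t) * G₀ r i j ∂μ = A t i j := by
    intro i j t ht
    have h1 := hI1 i t ht
    have h2 := hI1 j t ht
    have h3 := hI2 i j t ht
    have heq : (fun r => Real.exp (-r * t) * G₀ r i j) = fun r =>
        (Real.exp (-r * t) * g2 i j r - Real.exp (-r * t) * g1 i r -
          Real.exp (-r * t) * g1 j r) / 2 := by
      funext r
      simp only [G₀, Matrix.of_apply]; ring
    rw [heq]
    have h31 : Integrable (fun r => Real.exp (-r * t) * g2 i j r -
        Real.exp (-r * t) * g1 i r) μ := h3.1.sub h1.1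
    refine ⟨(h31.sub h2.1).div_const 2, ?_⟩
    rw [integral_div, integral_sub h31 h2.1, integral_sub h3.1 h1.1, h1.2, h2.2, h3.2]
    exact polarization_s17 (hpsd t ht).isHermitian i j
  have hform : ∀ v : Fin m → ℝ, ∀ᵐ r ∂μ, 0 ≤ v ⬝ᵥ (G₀ r).mulVec v := by
    intro v
    have hexpand : ∀ r t, Real.exp (-r * t) * (v ⬝ᵥ (G₀ r).mulVec v) =
        ∑ i, ∑ j, v i * (Real.exp (-r * t) * G₀ r i j * v j) := by
      intro r t
      simp only [dotProduct, mulVec, Finset.mul_sum]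
      exact Finset.sum_congr rfl fun i _ => Finset.sum_congr rfl fun j _ => by ring
    have hterm : ∀ t, 0 < t → ∀ i j,
        Integrable (fun r => v i * (Real.exp (-r * t) * G₀ r i j * v j)) μ := fun t ht i j =>
      ((hG₀I i j t ht).1.mul_const (v j)).const_mul (v i)
    have h_integral : ∀ t, 0 < t → ∫ r, Real.exp (-r * t) * (v ⬝ᵥ (G₀ r).mulVec v) ∂μ =
        v ⬝ᵥ (A t).mulVec v := by
      intro t ht
      simp_rw [hexpand]
      rw [integral_finsetSum _ fun i _ => integrable_finsetSum _ fun j _ => hterm t ht i j]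
      simp only [dotProduct, mulVec, Finset.mul_sum]
      refine Finset.sum_congr rfl fun i _ => ?_
      rw [integral_finsetSum _ fun j _ => hterm t ht i j]
      refine Finset.sum_congr rfl fun j _ => ?_
      rw [integral_const_mul, integral_mul_const, (hG₀I i j t ht).2]
    refine ae_nonneg_of_laplace hμ0 (hμs0 v) ?_ ?_ ?_ ?_
    · simp only [dotProduct, mulVec]
      exact Finset.measurable_sum _ fun i _ => (Finset.measurable_sum _ fun j _ =>
        (hG₀m i j).mul_const (v j)).const_mul (v i)
    · intro t ht
      simp_rw [hexpand]
      exact integrable_finsetSum _ fun i _ => integrable_finsetSum _ fun j _ => hterm t ht i j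
    · intro t ht
      rw [h_integral t ht]; exact hq0 v t ht
    · intro t ht
      rw [h_integral t ht]; exact hμs v t ht
  let S : Set ℝ := {r | (∀ i j, G₀ r i j = G₀ r j i) ∧ ∀ v : Fin m → ℚ,
    0 ≤ (fun i => (v i : ℝ)) ⬝ᵥ (G₀ r).mulVec fun i => (v i : ℝ)}
  have hSm : MeasurableSet S := by
    refine measurableSet_setOfPred.2 (Measurable.and (Measurable.forall fun i =>
      Measurable.forall fun j => measurableSet_setOfPred.1
        (measurableSet_eq_fun (hG₀m i j) (hG₀m j i))) (Measurable.forall fun v =>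
      measurableSet_setOfPred.1 (measurableSet_le measurable_const ?_)))
    simp only [dotProduct, mulVec]
    exact Finset.measurable_sum _ fun i _ => (Finset.measurable_sum _ fun j _ =>
      (hG₀m i j).mul_const _).const_mul _
  have hSae : ∀ᵐ r ∂μ, r ∈ S := by
    have h1 : ∀ᵐ r ∂μ, ∀ i j, g2 i j r = g2 j i r :=
      ae_all_iff.2 fun i => ae_all_iff.2 fun j => hsymm i j
    have h2 : ∀ᵐ r ∂μ, ∀ v : Fin m → ℚ,
        0 ≤ (fun i => (v i : ℝ)) ⬝ᵥ (G₀ r).mulVec fun i => (v i : ℝ) :=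
      ae_all_iff.2 fun v => hform _
    filter_upwards [h1, h2] with r hr1 hr2
    refine ⟨fun i j => ?_, hr2⟩
    simp only [G₀, Matrix.of_apply, hr1 i j]; ring
  let G : ℝ → Matrix (Fin m) (Fin m) ℝ := S.indicator G₀
  have hGapp : ∀ i j, (fun r => G r i j) = S.indicator fun r => G₀ r i j := by
    intro i j
    funext r
    by_cases hr : r ∈ S <;> simp [G, hr]
  have hGm : ∀ i j, Measurable fun r => G r i j := fun i j => by
    rw [hGapp]; exact (hG₀m i j).indicator hSm
  have hGb : ∀ i j r, |G r i j| ≤ 1 := fun i j r => by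
    rw [congrFun (hGapp i j) r]
    by_cases hr : r ∈ S
    · simpa [hr] using hG₀b r i j
    · simp [hr]
  have hrestr : μ.restrict (Ici 0) = μ := by
    refine Measure.restrict_eq_self_of_ae_mem ?_
    rw [ae_iff]; simpa [Iio] using hμ0
  have hrep : ∀ t, 0 < t → ∀ i j, A t i j = ∫ r, Real.exp (-r * t) * G r i j ∂μ := by
    intro t ht i j
    rw [← (hG₀I i j t ht).2]
    refine integral_congr_ae ?_
    filter_upwards [hSae] with r hr
    simp [G, hr]
  refine ⟨μ, G, hμ0, by rwa [hrestr], hGm, fun r => ?_, ⟨1, Eventually.of_forall fun r i j =>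
    hGb i j r⟩, fun t ht => ?_, fun p hp => ?_⟩
  · by_cases hr : r ∈ S
    · simp only [G, indicator_of_mem hr]
      exact posSemidef_of_rat (Matrix.IsHermitian.ext fun i j => by simpa using hr.1 j i) hr.2
    · simp only [G, indicator_of_notMem hr]
      exact Matrix.PosSemidef.zero
  · ext i j
    rw [hrestr, Matrix.of_apply]
    exact hrep t ht i j
  · ext i j
    rw [hrestr, Matrix.of_apply, matLaplace, Matrix.of_apply,
      ← laplace_laplace hμ0 hweight (hGm i j) (hGb i j) hp]
    exact setIntegral_congr_fun measurableSet_Ioi fun t ht => by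
      simp only [hrep t ht i j]
end
end
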